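/- arXiv:1812.11885 — 5 statements merged into one kernel-verified Lean document; each statement's English description precedes it below -/
import Mathlib

section
/- (Lemma 4.5) Let K be a field of characteristic zero and let a, b, u, v : ℕ → K be holonomic sequences over K. Then the sequence s : ℕ → K defined by s(d) = Σ_{k=1}^{d} a(k)·b(d−k)·( Σ_{ℓ=0}^{k−1} u(ℓ)·v(d−ℓ) ) is holonomic over K. -/
/-- A sequence `a : ℕ → K` is holonomic over `K` if it satisfies a nontrivial linear
recurrence `Σ_{i=0}^r p_i(d) · a(d+i) = 0` with polynomial coefficients `p_i ∈ K[x]`,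
not all zero. -/
def Holonomic {K : Type*} [Field K] (a : ℕ → K) : Prop :=
  ∃ (r : ℕ) (p : ℕ → Polynomial K),
    (∃ i ≤ r, p i ≠ 0) ∧
    ∀ d : ℕ, ∑ i ∈ Finset.range (r + 1), (p i).eval (d : K) * a (d + i) = 0


namespace Holonomic

open HahnSeries PowerSeries

section MonomialSubstitution

variable {Γ K : Type*} [AddCommGroup Γ] [LinearOrder Γ] [IsOrderedAddMonoid Γ] [Field K]

/-- The substitution `X ↦ T ^ v` of a monomial of positive exponent into a power series. -/
noncomputable def monomialSubst (v : Γ) (hv : 0 < v) : K⟦X⟧ →+* HahnSeries Γ K :=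
  (embDomainRingHom (multiplesHom Γ v) (nsmul_left_strictMono hv).injective
    (fun _ _ => (nsmul_left_strictMono hv).le_iff_le)).comp
    (toPowerSeries.symm : K⟦X⟧ ≃+* HahnSeries ℕ K).toRingHom

variable (v : Γ) (hv : 0 < v)

theorem monomialSubst_injective :
    Function.Injective (monomialSubst v hv : K⟦X⟧ → HahnSeries Γ K) :=
  embDomain_injective.comp toPowerSeries.symm.injective

theorem coeff_monomialSubst_nsmul (f : K⟦X⟧) (n : ℕ) :
    (monomialSubst v hv f).coeff (n • v) = PowerSeries.coeff n f := by
  rw [← coeff_toPowerSeries_symm]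
  exact embDomain_mk_coeff (f := multiplesHom Γ v) (nsmul_left_strictMono hv).injective
    (fun _ _ => (nsmul_left_strictMono hv).le_iff_le)

theorem coeff_monomialSubst_of_ne (f : K⟦X⟧) {γ : Γ} (h : ∀ n : ℕ, n • v ≠ γ) :
    (monomialSubst v hv f).coeff γ = 0 := by
  refine embDomain_of_notMem_range ?_
  rintro ⟨n, hn⟩
  exact h n hn

theorem coeff_monomialSubst_mul (f : K⟦X⟧) (y : HahnSeries Γ K) (γ : Γ) (S : Finset ℕ)
    (hS : ∀ n ∉ S, y.coeff (γ - n • v) = 0) :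
    (monomialSubst v hv f * y).coeff γ =
      ∑ n ∈ S, PowerSeries.coeff n f * y.coeff (γ - n • v) := by
  classical
  rw [HahnSeries.coeff_mul]
  symm
  refine Finset.sum_bij_ne_zero (fun n _ _ => (n • v, γ - n • v)) ?_ ?_ ?_ ?_
  · intro n _ h
    rw [Finset.mem_antidiagonal]
    refine ⟨?_, ?_, by simp⟩
    · rw [HahnSeries.mem_support, coeff_monomialSubst_nsmul]
      exact left_ne_zero_of_mul h
    · exact right_ne_zero_of_mul h
  · intro m _ _ n _ _ h
    exact (nsmul_left_strictMono hv).injective (congrArg Prod.fst h)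
  · rintro ⟨i, j⟩ hij h
    rw [Finset.mem_antidiagonal] at hij
    obtain ⟨n, rfl⟩ : ∃ n : ℕ, n • v = i := by
      by_contra! hn
      exact hij.1 (coeff_monomialSubst_of_ne v hv f hn)
    have hj : j = γ - n • v := by rw [← hij.2.2]; simp
    subst hj
    rw [coeff_monomialSubst_nsmul] at h
    exact ⟨n, by_contra fun hn => hij.2.1 (hS n hn), h, rfl⟩
  · intro n _ _
    rw [coeff_monomialSubst_nsmul]

end MonomialSubstitution

section Euler

variable {Γ K : Type*} [AddCommGroup Γ] [LinearOrder Γ] [IsOrderedAddMonoid Γ] [Field K]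

/-- The Euler derivation `T ^ γ ↦ l γ • T ^ γ` of Hahn series. -/
noncomputable def euler (l : Γ →+ ℤ) : Derivation K (HahnSeries Γ K) (HahnSeries Γ K) :=
  Derivation.mk'
    { toFun := fun x =>
        { coeff := fun γ => (l γ : K) * x.coeff γ
          isPWO_support' := x.isPWO_support.mono fun _ h => right_ne_zero_of_mul h }
      map_add' := fun x y => by ext γ; simp [mul_add]
      map_smul' := fun r x => by ext γ; simp [mul_left_comm] }
    (by
      intro x y
      ext γ
      have hx : (HahnSeries.mk (fun γ => (l γ : K) * x.coeff γ)
          (x.isPWO_support.mono fun _ h => right_ne_zero_of_mul h)).support ⊆ x.support :=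
        fun _ h => right_ne_zero_of_mul h
      have hy : (HahnSeries.mk (fun γ => (l γ : K) * y.coeff γ)
          (y.isPWO_support.mono fun _ h => right_ne_zero_of_mul h)).support ⊆ y.support :=
        fun _ h => right_ne_zero_of_mul h
      simp only [LinearMap.coe_mk, AddHom.coe_mk, smul_eq_mul, HahnSeries.coeff_add]
      rw [mul_comm y, HahnSeries.coeff_mul, HahnSeries.coeff_mul_left' x.isPWO_support hx,
        HahnSeries.coeff_mul_right' y.isPWO_support hy, Finset.mul_sum, ← Finset.sum_add_distrib]
      refine Finset.sum_congr rfl ?_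
      rintro ⟨i, j⟩ hij
      rw [Finset.mem_antidiagonal] at hij
      rw [← hij.2.2]
      simp only [map_add]
      push_cast
      ring)

@[simp]
theorem coeff_euler (l : Γ →+ ℤ) (x : HahnSeries Γ K) (γ : Γ) :
    (euler l x).coeff γ = (l γ : K) * x.coeff γ := rfl

theorem euler_monomialSubst (l : Γ →+ ℤ) (v : Γ) (hv : 0 < v) (f : ℕ → K) :
    euler l (monomialSubst v hv (PowerSeries.mk f)) =
      (l v : K) • monomialSubst v hv (PowerSeries.mk fun n => n * f n) := by
  ext γ
  rw [HahnSeries.coeff_smul, coeff_euler]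
  by_cases h : ∃ n : ℕ, n • v = γ
  · obtain ⟨n, rfl⟩ := h
    simp [coeff_monomialSubst_nsmul]
    ring
  · push Not at h
    simp [coeff_monomialSubst_of_ne v hv _ h]

end Euler

section Tame

variable {K : Type*} [Field K]

/-- The group `ℤ³` of exponents with its lexicographic order. -/
abbrev Exponent : Type := Lex (Fin 3 → ℤ)

/-- The coordinates of an exponent. -/
def coord (i : Fin 3) : Exponent →+ ℤ where
  toFun γ := ofLex γ i
  map_zero' := rfl
  map_add' _ _ := rfl

variable (K) in
/-- The Laurent polynomials whose exponents lie in the box `[-n, n]³`. -/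
def box (n : ℕ) : Submodule K (HahnSeries Exponent K) where
  carrier := {x | ∀ γ, x.coeff γ ≠ 0 → ∀ i, |coord i γ| ≤ n}
  zero_mem' := by simp
  add_mem' {x y} hx hy γ h := by
    by_cases h' : x.coeff γ = 0
    · exact hy γ (by simpa [h'] using h)
    · exact hx γ h'
  smul_mem' r x hx γ h := hx γ (by
    rw [HahnSeries.coeff_smul] at h
    exact right_ne_zero_of_mul h)

theorem box_mono : Monotone (box K) := fun _ _ hmn _ hx γ h i =>
  (hx γ h i).trans (by exact_mod_cast hmn)

theorem mul_mem_box {m n : ℕ} {x y : HahnSeries Exponent K} (hx : x ∈ box K m)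
    (hy : y ∈ box K n) : x * y ∈ box K (m + n) := by
  intro γ h i
  obtain ⟨a, ha, b, hb, rfl⟩ := support_mul_subset (x := x) (y := y) h
  have h1 := hx a ha i
  have h2 := hy b hb i
  rw [map_add]
  push_cast
  exact (abs_add_le _ _).trans (add_le_add h1 h2)

theorem euler_mem_box {n : ℕ} {x : HahnSeries Exponent K} (hx : x ∈ box K n)
    (l : Exponent →+ ℤ) : euler l x ∈ box K n :=
  fun γ h => hx γ (right_ne_zero_of_mul h)

theorem single_mem_box {n : ℕ} {γ : Exponent} (h : ∀ i, |coord i γ| ≤ n) (r : K) :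
    single γ r ∈ box K n := by
  intro δ hδ
  obtain rfl : δ = γ := by
    by_contra hne
    exact hδ (coeff_single_of_ne hne)
  exact h

theorem one_mem_box (n : ℕ) : (1 : HahnSeries Exponent K) ∈ box K n :=
  single_mem_box (by simp) 1

theorem box_mul_box_le (m n : ℕ) : box K m * box K n ≤ box K (m + n) :=
  Submodule.mul_le.2 fun _ hx _ hy => mul_mem_box hx hy

/-- Restriction of the coefficients of a Laurent polynomial to the box of its exponents. -/
def boxCoeff (n : ℕ) :
    box K n →ₗ[K] ((Fin 3 → Finset.Icc (-n : ℤ) n) → K) where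
  toFun x γ := x.1.coeff (toLex fun i => (γ i : ℤ))
  map_add' _ _ := rfl
  map_smul' _ _ := rfl

theorem boxCoeff_injective (n : ℕ) : Function.Injective (boxCoeff (K := K) n) := by
  rw [← LinearMap.ker_eq_bot, LinearMap.ker_eq_bot']
  rintro ⟨x, hx⟩ h
  ext γ
  by_contra hγ
  have hb := hx γ hγ
  exact hγ (congrFun h fun i => ⟨coord i γ, Finset.mem_Icc.2 (abs_le.1 (hb i))⟩)

instance (n : ℕ) : FiniteDimensional K (box K n) :=
  FiniteDimensional.of_injective _ (boxCoeff_injective n)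

theorem finrank_box_le (n : ℕ) : Module.finrank K (box K n) ≤ (2 * n + 1) ^ 3 := by
  refine (LinearMap.finrank_le_finrank_of_injective (boxCoeff_injective n)).trans ?_
  simp only [Module.finrank_fintype_fun_eq_card, Fintype.card_fun, Fintype.card_coe,
    Int.card_Icc, Fintype.card_fin]
  gcongr
  omega

/-- A Hahn series is tame if it lies in a finite-dimensional space `G` which is closed under the
Euler derivations up to Laurent polynomial factors, with a single denominator `Q`. -/
def Tame (x : HahnSeries Exponent K) : Prop :=
  ∃ (G : Submodule K (HahnSeries Exponent K)) (Q : HahnSeries Exponent K) (c : ℕ),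
    FiniteDimensional K G ∧ Q ≠ 0 ∧ Q ∈ box K c ∧ x ∈ G ∧
      ∀ i, ∀ g ∈ G, Q * euler (coord i) g ∈ box K c * G

theorem Tame.mul {x y : HahnSeries Exponent K} (hx : Tame x) (hy : Tame y) : Tame (x * y) := by
  obtain ⟨G, Q, c, hG, hQ, hQc, hxG, h⟩ := hx
  obtain ⟨G', Q', c', hG', hQ', hQc', hyG', h'⟩ := hy
  refine ⟨G * G', Q * Q', c + c', ?_, mul_ne_zero hQ hQ', mul_mem_box hQc hQc',
    Submodule.mul_mem_mul hxG hyG', fun i z hz => ?_⟩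
  · exact Module.Finite.iff_fg.2 ((Module.Finite.iff_fg.1 hG).mul (Module.Finite.iff_fg.1 hG'))
  · refine Submodule.mul_induction_on hz (fun a ha b hb => ?_) (fun a b ha hb => ?_)
    · have key : Q * Q' * euler (coord i) (a * b) =
          (Q * euler (coord i) a) * (Q' * b) + (Q * a) * (Q' * euler (coord i) b) := by
        rw [Derivation.leibniz, smul_eq_mul, smul_eq_mul]
        ring
      have hle : (box K c * G) * (box K c' * G') ≤ box K (c + c') * (G * G') := by
        rw [mul_mul_mul_comm]
        exact mul_le_mul' (box_mul_box_le c c') le_rfl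
      rw [key]
      exact add_mem
        (hle (Submodule.mul_mem_mul (h i a ha) (Submodule.mul_mem_mul hQc' hb)))
        (hle (Submodule.mul_mem_mul (Submodule.mul_mem_mul hQc ha) (h' i b hb)))
    · rw [map_add, mul_add]
      exact add_mem ha hb

theorem euler_single (l : Exponent →+ ℤ) (γ : Exponent) (r : K) :
    euler l (single γ r) = (l γ : K) • single γ r := by
  ext δ
  rw [HahnSeries.coeff_smul, coeff_euler, smul_eq_mul]
  by_cases h : δ = γ
  · rw [h]
  · simp [coeff_single_of_ne h]

theorem tame_single (γ : Exponent) (r : K) : Tame (single γ r : HahnSeries Exponent K) := by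
  refine ⟨K ∙ single γ r, 1, 0, inferInstance, one_ne_zero, one_mem_box 0,
    Submodule.mem_span_singleton_self _, fun i g hg => ?_⟩
  obtain ⟨s, rfl⟩ := Submodule.mem_span_singleton.1 hg
  refine Submodule.mul_mem_mul (one_mem_box 0) ?_
  rw [Derivation.map_smul, euler_single]
  exact Submodule.smul_mem _ _ (Submodule.smul_mem _ _ (Submodule.mem_span_singleton_self _))
theorem monomialSubst_polynomial_mem_box (v : Exponent) (hv : 0 < v) (p : Polynomial K) :
    ∃ m, monomialSubst v hv (p : K⟦X⟧) ∈ box K m := by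
  refine ⟨p.natDegree * ∑ i, (coord i v).natAbs, fun γ hγ i => ?_⟩
  obtain ⟨k, rfl⟩ : ∃ k : ℕ, k • v = γ := by
    by_contra! h
    exact hγ (coeff_monomialSubst_of_ne v hv _ h)
  rw [coeff_monomialSubst_nsmul, Polynomial.coeff_coe] at hγ
  rw [map_nsmul, Int.abs_eq_natAbs, nsmul_eq_mul, Int.natAbs_mul, Int.natAbs_natCast]
  have h1 := Polynomial.le_natDegree_of_ne_zero hγ
  have h2 := Finset.single_le_sum (f := fun i => (coord i v).natAbs)
    (fun _ _ => Nat.zero_le _) (Finset.mem_univ i)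
  exact_mod_cast Nat.mul_le_mul h1 h2

theorem tame_monomialSubst (v : Exponent) (hv : 0 < v) (a : ℕ → K) (n : ℕ)
    (c : ℕ → Polynomial K) (hn : c n ≠ 0)
    (h : ∑ j ∈ Finset.range (n + 1),
      (c j : K⟦X⟧) * PowerSeries.mk (fun k => (k : K) ^ j * a k) = 0) :
    Tame (monomialSubst v hv (PowerSeries.mk a)) := by
  set Y : ℕ → HahnSeries Exponent K := fun j =>
    monomialSubst v hv (PowerSeries.mk (fun k => (k : K) ^ j * a k)) with hY
  choose m hm using fun j => monomialSubst_polynomial_mem_box v hv (c j)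
  have hrel : ∑ j ∈ Finset.range (n + 1), monomialSubst v hv (c j : K⟦X⟧) * Y j = 0 := by
    have := congrArg (monomialSubst v hv) h
    rw [map_sum, map_zero] at this
    simpa only [map_mul] using this
  have hQ : monomialSubst v hv (c n : K⟦X⟧) ≠ 0 := by
    rw [← map_zero (monomialSubst v hv)]
    refine (monomialSubst_injective v hv).ne ?_
    simpa using hn
  have hY0 : monomialSubst v hv (PowerSeries.mk a) = Y 0 := by simp [hY]
  have hstep : ∀ i j, euler (coord i) (Y j) = (coord i v : K) • Y (j + 1) := by
    intro i j
    simp only [hY]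
    rw [euler_monomialSubst]
    simp only [pow_succ', mul_assoc]
  have hmem : ∀ j < n, Y j ∈ Submodule.span K (Y '' Set.Iio n) := fun j hj =>
    Submodule.subset_span ⟨j, hj, rfl⟩
  have hbox : ∀ j ≤ n, monomialSubst v hv (c j : K⟦X⟧) ∈
      box K ((Finset.range (n + 1)).sup m) := fun j hj =>
    box_mono (Finset.le_sup (Finset.mem_range.2 (Nat.lt_succ_of_le hj))) (hm j)
  rw [hY0]
  refine ⟨Submodule.span K (Y '' Set.Iio n), monomialSubst v hv (c n : K⟦X⟧),
    (Finset.range (n + 1)).sup m,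
    FiniteDimensional.span_of_finite K ((Set.finite_Iio n).image Y), hQ, hbox n le_rfl, ?_, ?_⟩
  · rcases Nat.eq_zero_or_pos n with rfl | hpos
    · have : Y 0 = 0 := by simpa [hQ] using hrel
      rw [this]
      exact zero_mem _
    · exact hmem 0 hpos
  · intro i g hg
    induction hg using Submodule.span_induction with
    | zero => simp
    | add x y _ _ hx hy => rw [map_add, mul_add]; exact add_mem hx hy
    | smul r x _ hx =>
      rw [Derivation.map_smul, mul_smul_comm]
      exact Submodule.smul_mem _ _ hx
    | mem x hx =>
      obtain ⟨j, hj, rfl⟩ := hx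
      rw [hstep, mul_smul_comm]
      refine Submodule.smul_mem _ _ ?_
      rcases (Nat.succ_le_of_lt hj).lt_or_eq with hlt | heq
      · exact Submodule.mul_mem_mul (hbox n le_rfl) (hmem _ hlt)
      · rw [Nat.succ_eq_add_one] at heq
        rw [heq]
        rw [Finset.sum_range_succ, add_comm] at hrel
        rw [eq_neg_of_add_eq_zero_left hrel]
        refine neg_mem (sum_mem fun k hk => ?_)
        have hk := Finset.mem_range.1 hk
        exact Submodule.mul_mem_mul (hbox k hk.le) (hmem k hk)

end Tame

section Recurrence

variable {K : Type*} [Field K]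

open Polynomial in
/-- A holonomic sequence satisfies a recurrence in backward shifts which remains valid when the
sequence is extended by zero to negative indices. -/
theorem exists_backward_recurrence [CharZero K] {a : ℕ → K} (ha : Holonomic a) :
    ∃ (r : ℕ) (C : ℕ → Polynomial K), (∃ i ≤ r, C i ≠ 0) ∧
      ∑ i ∈ Finset.range (r + 1),
        (PowerSeries.X ^ i * PowerSeries.mk fun k => (C i).eval (k : K) * a k : K⟦X⟧) = 0 := by
  obtain ⟨r, p, ⟨i₀, hi₀, hp⟩, h⟩ := ha
  set q : Polynomial K := ∏ j ∈ Finset.range r, (Polynomial.X - Polynomial.C (j : K)) with hq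
  have hq0 : q ≠ 0 := Finset.prod_ne_zero_iff.2 fun j _ => Polynomial.X_sub_C_ne_zero _
  refine ⟨r, fun i => taylor (i : K) q * taylor ((i : K) - r) (p (r - i)),
    ⟨r - i₀, Nat.sub_le _ _, mul_ne_zero ?_ ?_⟩, ?_⟩
  · rwa [Ne, taylor_eq_zero]
  · rw [Nat.sub_sub_self hi₀]
    rwa [Ne, taylor_eq_zero]
  · ext n
    simp only [map_sum, PowerSeries.coeff_X_pow_mul', PowerSeries.coeff_mk, map_zero, eval_mul,
      taylor_eval]
    rcases lt_or_ge n r with hn | hn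
    · refine Finset.sum_eq_zero fun i _ => ?_
      split_ifs with hi
      · have : q.eval (n : K) = 0 := by
          rw [hq, eval_prod]
          exact Finset.prod_eq_zero (Finset.mem_range.2 hn) (by simp)
        rw [Nat.cast_sub hi, sub_add_cancel, this, zero_mul, zero_mul]
      · rfl
    · obtain ⟨d, rfl⟩ := Nat.exists_eq_add_of_le' hn
      have := congrArg (q.eval ((d + r : ℕ) : K) * ·) (h d)
      simp only [mul_zero] at this
      rw [← this, ← Finset.sum_range_reflect, Finset.mul_sum]
      refine Finset.sum_congr rfl fun i hi => ?_
      have hi := Nat.lt_succ_iff.1 (Finset.mem_range.1 hi)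
      rw [show r + 1 - 1 - i = r - i by omega, if_pos (by omega), Nat.sub_sub_self hi,
        show d + r - (r - i) = d + i by omega, Nat.cast_sub hi]
      push_cast
      rw [show (d + i + (r - i) : K) = d + r by ring,
        show (d + i + (r - i - r) : K) = d by ring, mul_assoc]

theorem holonomic_of_backward_recurrence {s : ℕ → K} (r : ℕ) (C : ℕ → Polynomial K)
    (hC : ∃ i ≤ r, C i ≠ 0)
    (h : ∀ n : ℕ, r ≤ n → ∑ i ∈ Finset.range (r + 1),
      (C i).eval ((n : K) - i) * s (n - i) = 0) : Holonomic s := by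
  obtain ⟨i₀, hi₀, hC⟩ := hC
  refine ⟨r, fun i => Polynomial.taylor (i : K) (C (r - i)),
    ⟨r - i₀, Nat.sub_le _ _, ?_⟩, fun d => ?_⟩
  · dsimp only
    rw [Nat.sub_sub_self hi₀]
    rwa [Ne, Polynomial.taylor_eq_zero]
  · rw [← h (d + r) (Nat.le_add_left _ _), ← Finset.sum_range_reflect]
    refine Finset.sum_congr rfl fun i hi => ?_
    have hi := Nat.lt_succ_iff.1 (Finset.mem_range.1 hi)
    rw [Polynomial.taylor_eval, show r + 1 - 1 - i = r - i by omega, Nat.sub_sub_self hi,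
      show d + r - i = d + (r - i) by omega, Nat.cast_sub hi]
    push_cast
    rw [add_sub_assoc]

theorem exists_differential_equation [CharZero K] {a : ℕ → K} (ha : Holonomic a) :
    ∃ (n : ℕ) (c : ℕ → Polynomial K), c n ≠ 0 ∧
      ∑ j ∈ Finset.range (n + 1),
        (c j : K⟦X⟧) * PowerSeries.mk (fun k => (k : K) ^ j * a k) = 0 := by
  classical
  obtain ⟨r, C, ⟨i₀, hi₀, hC⟩, h⟩ := exists_backward_recurrence ha
  set c : ℕ → Polynomial K := fun j =>
    ∑ i ∈ Finset.range (r + 1), Polynomial.C ((C i).coeff j) * Polynomial.X ^ i with hc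
  set N := (Finset.range (r + 1)).sup fun i => (C i).natDegree with hN
  have hdeg : ∀ i ∈ Finset.range (r + 1), (C i).natDegree ≤ N := fun i hi =>
    Finset.le_sup (f := fun i => (C i).natDegree) hi
  have hcne : c (C i₀).natDegree ≠ 0 := by
    intro h0
    have := congrArg (fun p => Polynomial.coeff p i₀) h0
    simp [hc, Polynomial.coeff_X_pow, Nat.lt_succ_of_le hi₀] at this
    exact hC this
  set S := (Finset.range (N + 1)).filter fun j => c j ≠ 0 with hS
  have hSne : S.Nonempty := ⟨(C i₀).natDegree, Finset.mem_filter.2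
    ⟨Finset.mem_range.2 (Nat.lt_succ_of_le (hdeg _ (Finset.mem_range.2 (by omega)))), hcne⟩⟩
  have hmax := Finset.mem_filter.1 (S.max'_mem hSne)
  refine ⟨S.max' hSne, c, hmax.2, ?_⟩
  have hsum : ∑ j ∈ Finset.range (N + 1),
      (c j : K⟦X⟧) * PowerSeries.mk (fun k => (k : K) ^ j * a k) = 0 := by
    rw [← h]
    have hcoe : ∀ j, (c j : K⟦X⟧) = ∑ i ∈ Finset.range (r + 1),
        PowerSeries.C ((C i).coeff j) * PowerSeries.X ^ i := fun j => by
      rw [hc, ← Polynomial.coeToPowerSeries.ringHom_apply, map_sum]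
      simp
    simp only [hcoe, Finset.sum_mul]
    rw [Finset.sum_comm]
    refine Finset.sum_congr rfl fun i hi => ?_
    have hmk : (PowerSeries.mk fun k => (C i).eval (k : K) * a k : K⟦X⟧) =
        ∑ j ∈ Finset.range (N + 1), PowerSeries.C ((C i).coeff j) *
          PowerSeries.mk fun k => (k : K) ^ j * a k := by
      ext k
      simp only [map_sum, PowerSeries.coeff_mk, PowerSeries.coeff_C_mul]
      rw [Polynomial.eval_eq_sum_range' (Nat.lt_succ_of_le (hdeg i hi)), Finset.sum_mul]
      exact Finset.sum_congr rfl fun j _ => mul_assoc _ _ _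
    rw [hmk, Finset.mul_sum]
    exact Finset.sum_congr rfl fun j _ => by ring
  rw [← hsum]
  refine Finset.sum_subset (Finset.range_subset_range.2 (Finset.mem_range.1 hmax.1)) ?_
  intro j hj hj'
  have : c j = 0 := by
    by_contra hne
    have := S.le_max' j (Finset.mem_filter.2 ⟨hj, hne⟩)
    exact hj' (Finset.mem_range.2 (Nat.lt_succ_of_le this))
  simp [this]

end Recurrence

section Residue

variable {K : Type*} [Field K]

/-- The unit vectors of `ℤ³`. -/
def unitExponent (i : Fin 3) : Exponent := toLex (Pi.single i 1)

theorem coord_unitExponent (i j : Fin 3) : coord i (unitExponent j) = if i = j then 1 else 0 :=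
  Pi.single_apply j 1 i

/-- The partial derivative of a Hahn series. -/
noncomputable def partialDeriv (i : Fin 3) (x : HahnSeries Exponent K) : HahnSeries Exponent K :=
  single (-unitExponent i) 1 * euler (coord i) x

theorem coeff_iterate_euler (l : Exponent →+ ℤ) (k : ℕ) (x : HahnSeries Exponent K)
    (γ : Exponent) : ((euler l)^[k] x).coeff γ = (l γ : K) ^ k * x.coeff γ := by
  induction k with
  | zero => simp
  | succ k ih => rw [Function.iterate_succ_apply', coeff_euler, ih, pow_succ', mul_assoc]

theorem coeff_iterate_partialDeriv (i : Fin 3) (k : ℕ) (x : HahnSeries Exponent K)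
    (γ : Exponent) : ((partialDeriv i)^[k] x).coeff γ =
      (∏ j ∈ Finset.range k, ((coord i γ : K) + 1 + j)) *
        x.coeff (γ + k • unitExponent i) := by
  induction k generalizing γ with
  | zero => simp
  | succ k ih =>
    rw [Function.iterate_succ_apply', partialDeriv, coeff_single_mul, one_mul, sub_neg_eq_add,
      coeff_euler, ih, Finset.prod_range_succ', map_add, coord_unitExponent, if_pos rfl,
      add_assoc γ, ← succ_nsmul']
    push_cast
    rw [add_zero, mul_comm (∏ _ ∈ _, _) ((_ : K) + 1), mul_assoc]
    congr 3
    funext j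
    ring

section Growth

variable {G : Submodule K (HahnSeries Exponent K)} {Q : HahnSeries Exponent K} {c : ℕ}

theorem mul_level (hQ : Q ∈ box K c) {N : ℕ} {m x : HahnSeries Exponent K} (hm : m ∈ box K 1)
    (hx : Q ^ N * x ∈ box K ((c + 1) * N) * G) :
    Q ^ (N + 1) * (m * x) ∈ box K ((c + 1) * (N + 1)) * G := by
  have := Submodule.mul_mem_mul (mul_mem_box hQ hm) hx
  rw [← mul_assoc] at this
  have hle := mul_le_mul' (box_mul_box_le (K := K) (c + 1) ((c + 1) * N)) (le_refl G) this
  rw [show (c + 1) * (N + 1) = c + 1 + (c + 1) * N by ring]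
  convert hle using 1
  ring

theorem level_mono (hQ : Q ∈ box K c) {N M : ℕ} (hNM : N ≤ M) {x : HahnSeries Exponent K}
    (hx : Q ^ N * x ∈ box K ((c + 1) * N) * G) : Q ^ M * x ∈ box K ((c + 1) * M) * G := by
  induction M, hNM using Nat.le_induction with
  | base => exact hx
  | succ M _ ih => simpa using mul_level hQ (one_mem_box 1) ih

theorem euler_level (hQ : Q ∈ box K c) {i : Fin 3}
    (h : ∀ g ∈ G, Q * euler (coord i) g ∈ box K c * G) {N : ℕ} {x : HahnSeries Exponent K}
    (hx : Q ^ N * x ∈ box K ((c + 1) * N) * G) :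
    Q ^ (N + 1) * euler (coord i) x ∈ box K ((c + 1) * (N + 1)) * G := by
  have hle : box K c * (box K ((c + 1) * N) * G) ≤ box K ((c + 1) * (N + 1)) * G := by
    rw [← mul_assoc]
    refine mul_le_mul' ((box_mul_box_le _ _).trans (box_mono ?_)) le_rfl
    rw [mul_add]
    omega
  have hD : ∀ y ∈ box K ((c + 1) * N) * G, Q * euler (coord i) y ∈
      box K c * (box K ((c + 1) * N) * G) := by
    intro y hy
    refine Submodule.mul_induction_on hy (fun a ha g hg => ?_) (fun a b ha hb => ?_)
    · rw [Derivation.leibniz, smul_eq_mul, smul_eq_mul, mul_add]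
      refine add_mem ?_ ?_
      · rw [mul_left_comm Q, mul_left_comm (box K c)]
        exact Submodule.mul_mem_mul ha (h g hg)
      · rw [mul_comm g]
        exact Submodule.mul_mem_mul hQ (Submodule.mul_mem_mul (euler_mem_box ha _) hg)
    · rw [map_add, mul_add]
      exact add_mem ha hb
  have key : Q ^ (N + 1) * euler (coord i) x =
      Q * euler (coord i) (Q ^ N * x) - (N : K) • (euler (coord i) Q * (Q ^ N * x)) := by
    rw [Derivation.leibniz, Derivation.leibniz_pow, smul_eq_mul, smul_eq_mul, smul_eq_mul,
      Nat.cast_smul_eq_nsmul]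
    rcases N with _ | N
    · simp
    · simp only [nsmul_eq_mul, Nat.add_sub_cancel]
      ring
  rw [key]
  exact hle (sub_mem (hD _ hx) (Submodule.smul_mem _ _
    (Submodule.mul_mem_mul (euler_mem_box hQ _) hx)))

theorem finrank_box_mul_le [FiniteDimensional K G] (N : ℕ) :
    Module.finrank K (box K N * G : Submodule K (HahnSeries Exponent K)) ≤
      (2 * N + 1) ^ 3 * Module.finrank K G := by
  rw [← Submodule.mulMap_range]
  refine (LinearMap.finrank_range_le _).trans ?_
  rw [Module.finrank_tensorProduct]
  exact Nat.mul_le_mul_right _ (finrank_box_le N)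

end Growth

theorem single_neg_unitExponent_mem_box (i : Fin 3) :
    single (-unitExponent i) (1 : K) ∈ box K 1 := by
  refine single_mem_box (fun j => ?_) 1
  rw [map_neg, abs_neg, coord_unitExponent]
  split_ifs <;> simp

theorem single_unitExponent_mem_box (i : Fin 3) :
    single (unitExponent i) (1 : K) ∈ box K 1 := by
  refine single_mem_box (fun j => ?_) 1
  rw [coord_unitExponent]
  split_ifs <;> simp

/-- The differential monomials `t ^ α (t ∂ₜ) ^ β ∂₁ ^ γ ∂₂ ^ δ`, applied to a Hahn series. -/
noncomputable def diffMonomial (α β γ δ : ℕ) (x : HahnSeries Exponent K) :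
    HahnSeries Exponent K :=
  (single (unitExponent 0) 1 * ·)^[α]
    ((euler (coord 0))^[β] ((partialDeriv 1)^[γ] ((partialDeriv 2)^[δ] x)))

theorem Tame.exists_relation {x : HahnSeries Exponent K} (hx : Tame x) :
    ∃ (n : ℕ) (w : Fin (n + 1) × Fin (n + 1) × Fin (n + 1) × Fin (n + 1) → K), w ≠ 0 ∧
      ∑ z, w z • diffMonomial z.1 z.2.1 z.2.2.1 z.2.2.2 x = 0 := by
  obtain ⟨G, Q, c, hG, hQ, hQc, hxG, h⟩ := hx
  have iter : ∀ (f : HahnSeries Exponent K → HahnSeries Exponent K) (e : ℕ),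
      (∀ N y, Q ^ N * y ∈ box K ((c + 1) * N) * G →
        Q ^ (N + e) * f y ∈ box K ((c + 1) * (N + e)) * G) →
      ∀ (k N : ℕ) y, Q ^ N * y ∈ box K ((c + 1) * N) * G →
        Q ^ (N + e * k) * f^[k] y ∈ box K ((c + 1) * (N + e * k)) * G := by
    intro f e hf k N y hy
    induction k with
    | zero => simpa using hy
    | succ k ih =>
      rw [Function.iterate_succ_apply', mul_add_one, ← add_assoc]
      exact hf _ _ ih
  have hpartial : ∀ i N y, Q ^ N * y ∈ box K ((c + 1) * N) * G →
      Q ^ (N + 2) * partialDeriv i y ∈ box K ((c + 1) * (N + 2)) * G := fun i N y hy =>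
    mul_level hQc (single_neg_unitExponent_mem_box i) (euler_level hQc (h i) hy)
  have hmono : ∀ n α β γ δ : ℕ, α ≤ n → β ≤ n → γ ≤ n → δ ≤ n →
      Q ^ (6 * n) * diffMonomial α β γ δ x ∈ box K ((c + 1) * (6 * n)) * G := by
    intro n α β γ δ hα hβ hγ hδ
    have h0 : Q ^ 0 * x ∈ box K ((c + 1) * 0) * G := by
      rw [pow_zero]
      exact Submodule.mul_mem_mul (one_mem_box _) hxG
    have h1 := iter _ 2 (hpartial 2) δ _ _ h0
    have h2 := iter _ 2 (hpartial 1) γ _ _ h1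
    have h3 := iter (euler (coord 0)) 1 (fun N y => euler_level hQc (h 0)) β _ _ h2
    have h4 := iter (single (unitExponent 0) 1 * ·) 1
      (fun N y => mul_level hQc (single_unitExponent_mem_box 0)) α _ _ h3
    exact level_mono hQc (by omega) h4
  set n := (12 * (c + 1)) ^ 3 * Module.finrank K G with hn
  set V := box K ((c + 1) * (6 * n)) * G with hV
  have hVfin : FiniteDimensional K V := Module.Finite.iff_fg.2
    ((Module.Finite.iff_fg.1 inferInstance).mul (Module.Finite.iff_fg.1 hG))
  let f : Fin (n + 1) × Fin (n + 1) × Fin (n + 1) × Fin (n + 1) → V := fun z =>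
    ⟨Q ^ (6 * n) * diffMonomial z.1 z.2.1 z.2.2.1 z.2.2.2 x,
      hmono n _ _ _ _ (Nat.lt_succ_iff.1 z.1.2) (Nat.lt_succ_iff.1 z.2.1.2)
        (Nat.lt_succ_iff.1 z.2.2.1.2) (Nat.lt_succ_iff.1 z.2.2.2.2)⟩
  have hdep : ¬ LinearIndependent K f := by
    intro hf
    have h1 := hf.fintype_card_le_finrank
    have h2 := h1.trans (finrank_box_mul_le _)
    simp only [Fintype.card_prod, Fintype.card_fin] at h2
    have h3 : (2 * ((c + 1) * (6 * n)) + 1) ^ 3 ≤ (12 * (c + 1) * (n + 1)) ^ 3 := by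
      gcongr
      nlinarith
    have h4 := h2.trans (Nat.mul_le_mul_right _ h3)
    rw [mul_pow, mul_right_comm, ← hn] at h4
    have : 0 < (n + 1) ^ 3 := by positivity
    nlinarith
  obtain ⟨w, hw, z, hz⟩ := Fintype.not_linearIndependent_iff.1 hdep
  refine ⟨n, w, fun h0 => hz (congrFun h0 z), ?_⟩
  have := congrArg Subtype.val hw
  simp only [f, Submodule.coe_sum, Submodule.coe_smul, ZeroMemClass.coe_zero,
    ← mul_smul_comm, ← Finset.mul_sum] at this
  exact (mul_eq_zero.1 this).resolve_left (pow_ne_zero _ hQ)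

theorem exponent_ext {γ δ : Exponent} (h : ∀ i, coord i γ = coord i δ) : γ = δ :=
  ofLex.injective (funext h)

/-- The exponent with the given coordinates. -/
def exponent (d e f : ℤ) : Exponent := toLex ![d, e, f]

@[simp]
theorem coord_zero_exponent (d e f : ℤ) : coord 0 (exponent d e f) = d := rfl

@[simp]
theorem coord_one_exponent (d e f : ℤ) : coord 1 (exponent d e f) = e := rfl

@[simp]
theorem coord_two_exponent (d e f : ℤ) : coord 2 (exponent d e f) = f := rfl

theorem coeff_diffMonomial (α β γ δ : ℕ) (x : HahnSeries Exponent K) (d e f : ℤ) :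
    (diffMonomial α β γ δ x).coeff (exponent d e f) =
      ((d - α : ℤ) : K) ^ β * ((∏ j ∈ Finset.range γ, ((e : K) + 1 + j)) *
        ((∏ j ∈ Finset.range δ, ((f : K) + 1 + j)) *
          x.coeff (exponent (d - α) (e + γ) (f + δ)))) := by
  rw [diffMonomial, mul_left_iterate]
  have h1 : (single (unitExponent 0) (1 : K)) ^ α = single (α • unitExponent 0) 1 := by
    rw [single_pow, one_pow]
  have h2 : exponent d e f - α • unitExponent 0 = exponent (d - α) e f := by
    refine exponent_ext fun i => ?_
    rw [map_sub, map_nsmul, coord_unitExponent]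
    fin_cases i <;> simp
  have h3 : exponent (d - α) e f + γ • unitExponent 1 = exponent (d - α) (e + γ) f := by
    refine exponent_ext fun i => ?_
    rw [map_add, map_nsmul, coord_unitExponent]
    fin_cases i <;> simp
  have h4 : exponent (d - α) (e + γ) f + δ • unitExponent 2 =
      exponent (d - α) (e + γ) (f + δ) := by
    refine exponent_ext fun i => ?_
    rw [map_add, map_nsmul, coord_unitExponent]
    fin_cases i <;> simp
  rw [h1, coeff_single_mul, one_mul, h2, coeff_iterate_euler, coeff_iterate_partialDeriv, h3,
    coeff_iterate_partialDeriv, h4]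
  rfl

theorem prod_range_shift_eq_zero {m k : ℕ} (h : m < k) :
    ∏ j ∈ Finset.range k, (((-1 - m : ℤ) : K) + 1 + j) = 0 :=
  Finset.prod_eq_zero (Finset.mem_range.2 h) (by push_cast; ring)

theorem prod_range_shift_ne_zero [CharZero K] (m : ℕ) :
    ∏ j ∈ Finset.range m, (((-1 - m : ℤ) : K) + 1 + j) ≠ 0 := by
  refine Finset.prod_ne_zero_iff.2 fun j hj h => ?_
  have hj := Finset.mem_range.1 hj
  have : ((-1 - m + 1 + j : ℤ) : K) = 0 := by rw [← h]; push_cast; ring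
  have := Int.cast_eq_zero.1 this
  omega

/-- The residue of a tame Hahn series in two of the variables is holonomic. -/
theorem Tame.holonomic_residue [CharZero K] {x : HahnSeries Exponent K} (hx : Tame x) :
    Holonomic fun d : ℕ => x.coeff (exponent d (-1) (-1)) := by
  classical
  obtain ⟨n, w, hw, hrel⟩ := hx.exists_relation
  obtain ⟨z', hz'⟩ := Function.ne_iff.1 hw
  obtain ⟨z₀, hz₀, hmin⟩ := Finset.exists_min_image (Finset.univ.filter fun z => w z ≠ 0)
    (fun z => toLex (z.2.2.1, z.2.2.2)) ⟨z', by simpa using hz'⟩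
  have hz₀ : w z₀ ≠ 0 := (Finset.mem_filter.1 hz₀).2
  obtain ⟨α₀, β₀, γ₀, δ₀⟩ := z₀
  set P : ℕ → Polynomial K := fun i => ∑ z, if (z.1 : ℕ) = i ∧ z.2.2.1 = γ₀ ∧ z.2.2.2 = δ₀ then
    Polynomial.C (w z) * Polynomial.X ^ (z.2.1 : ℕ) else 0 with hP
  refine holonomic_of_backward_recurrence n P ⟨α₀, Nat.lt_succ_iff.1 α₀.2, fun h0 => hz₀ ?_⟩
    fun m hm => ?_
  · have := congrArg (fun p => Polynomial.coeff p (β₀ : ℕ)) h0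
    simp only [hP, Polynomial.finsetSum_coeff, Polynomial.coeff_zero] at this
    rw [Finset.sum_eq_single (α₀, β₀, γ₀, δ₀)] at this
    · simpa using this
    · rintro ⟨α, β, γ, δ⟩ - hne
      split_ifs with hcond
      · obtain ⟨h1, h2, h3⟩ := hcond
        dsimp only at h1 h2 h3
        obtain rfl := Fin.ext h1
        subst h2 h3
        have : (β₀ : ℕ) ≠ β := fun hb => hne (by rw [Fin.ext hb])
        simp [Polynomial.coeff_X_pow, this]
      · simp
    · simp
  · have key := congrArg (fun y => y.coeff (exponent m (-1 - (γ₀ : ℕ)) (-1 - (δ₀ : ℕ)))) hrel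
    simp only [HahnSeries.coeff_sum, HahnSeries.coeff_smul, HahnSeries.coeff_zero,
      coeff_diffMonomial, smul_eq_mul] at key
    have hterm : ∀ z : Fin (n + 1) × Fin (n + 1) × Fin (n + 1) × Fin (n + 1),
        w z * ((((m : ℤ) - (z.1 : ℕ) : ℤ) : K) ^ (z.2.1 : ℕ) *
          ((∏ j ∈ Finset.range z.2.2.1, (((-1 - (γ₀ : ℕ) : ℤ) : K) + 1 + j)) *
          ((∏ j ∈ Finset.range z.2.2.2, (((-1 - (δ₀ : ℕ) : ℤ) : K) + 1 + j)) *
          x.coeff (exponent (m - (z.1 : ℕ)) (-1 - (γ₀ : ℕ) + (z.2.2.1 : ℕ))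
            (-1 - (δ₀ : ℕ) + (z.2.2.2 : ℕ)))))) =
        ((∏ j ∈ Finset.range γ₀, (((-1 - (γ₀ : ℕ) : ℤ) : K) + 1 + j)) *
          (∏ j ∈ Finset.range δ₀, (((-1 - (δ₀ : ℕ) : ℤ) : K) + 1 + j))) *
        if z.2.2.1 = γ₀ ∧ z.2.2.2 = δ₀ then
          w z * ((m : K) - (z.1 : ℕ)) ^ (z.2.1 : ℕ) *
            x.coeff (exponent ((m - z.1 : ℕ) : ℤ) (-1) (-1)) else 0 := by
      rintro ⟨α, β, γ, δ⟩
      dsimp only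
      by_cases hwz : w (α, β, γ, δ) = 0
      · simp [hwz]
      have hlex := hmin (α, β, γ, δ) (by simpa using hwz)
      rw [Prod.Lex.toLex_le_toLex] at hlex
      dsimp only at hlex
      rcases hlex with hlt | ⟨heq, hle⟩
      · rw [prod_range_shift_eq_zero (K := K) (Fin.lt_def.1 hlt), if_neg fun h => hlt.ne' h.1]
        ring
      · subst heq
        rcases hle.lt_or_eq with hlt | heq
        · rw [prod_range_shift_eq_zero (K := K) (Fin.lt_def.1 hlt), if_neg fun h => hlt.ne' h.2]
          ring
        · subst heq
          rw [if_pos ⟨rfl, rfl⟩, Nat.cast_sub ((Nat.lt_succ_iff.1 α.2).trans hm)]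
          simp only [sub_add_cancel]
          push_cast
          ring
    rw [Finset.sum_congr rfl fun z _ => hterm z, ← Finset.mul_sum] at key
    have key := (mul_eq_zero.1 key).resolve_left
      (mul_ne_zero (prod_range_shift_ne_zero _) (prod_range_shift_ne_zero _))
    rw [← key]
    simp only [hP, Polynomial.eval_finsetSum, Finset.sum_mul]
    rw [Finset.sum_comm]
    refine Finset.sum_congr rfl fun z _ => ?_
    rw [Finset.sum_eq_single (z.1 : ℕ)]
    · split_ifs with h1 h2 h2
      · simp
      · exact absurd h1.2 h2
      · exact absurd ⟨rfl, h2⟩ h1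
      · simp
    · intro i _ hi
      rw [if_neg fun h => hi h.1.symm]
      simp
    · intro h
      exact absurd (Finset.mem_range.2 z.1.2) h

end Residue

section Convolution

variable {K : Type*} [Field K]

/-- Extension of a sequence by zero to negative indices. -/
def extendZero (a : ℕ → K) (n : ℤ) : K := if 0 ≤ n then a n.toNat else 0

theorem extendZero_natCast (a : ℕ → K) (n : ℕ) : extendZero a n = a n := by simp [extendZero]

theorem extendZero_of_neg (a : ℕ → K) {n : ℤ} (hn : n < 0) : extendZero a n = 0 :=
  if_neg hn.not_ge

theorem extendZero_sub (a : ℕ → K) {m n : ℕ} (h : m ≤ n) :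
    extendZero a ((n : ℤ) - m) = a (n - m) := by
  rw [← Nat.cast_sub h, extendZero_natCast]

theorem coeff_monomialSubst_mul_eq_single {Γ : Type*} [AddCommGroup Γ] [LinearOrder Γ]
    [IsOrderedAddMonoid Γ] (v : Γ) (hv : 0 < v) (a : ℕ → K) (y : HahnSeries Γ K) (γ : Γ) (k : ℤ)
    (h : ∀ n : ℕ, (n : ℤ) ≠ k → y.coeff (γ - n • v) = 0) :
    (monomialSubst v hv (PowerSeries.mk a) * y).coeff γ =
      extendZero a k * y.coeff (γ - k • v) := by
  rcases lt_or_ge k 0 with hk | hk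
  · rw [extendZero_of_neg a hk, zero_mul,
      coeff_monomialSubst_mul v hv _ y γ ∅ fun n _ => h n (by omega), Finset.sum_empty]
  · lift k to ℕ using hk
    rw [coeff_monomialSubst_mul v hv _ y γ {k} fun n hn => h n (by simpa using hn),
      Finset.sum_singleton, PowerSeries.coeff_mk, extendZero_natCast, natCast_zsmul]

theorem exponent_pos_of_first {d : ℤ} (e f : ℤ) (hd : 0 < d) : 0 < exponent d e f :=
  ⟨0, by simp, hd⟩

theorem exponent_pos_of_second {e : ℤ} (f : ℤ) (he : 0 < e) : 0 < exponent 0 e f :=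
  ⟨1, fun j hj => by obtain rfl : j = 0 := by omega
                     rfl, he⟩

theorem exponent_pos_of_third {f : ℤ} (hf : 0 < f) : 0 < exponent 0 0 f :=
  ⟨2, fun j hj => by fin_cases j <;> first | rfl | exact absurd hj (by decide), hf⟩

theorem exponent_sub_zsmul (d e f d' e' f' k : ℤ) :
    exponent d e f - k • exponent d' e' f' =
      exponent (d - k * d') (e - k * e') (f - k * f') := by
  refine exponent_ext fun i => ?_
  rw [map_sub, map_zsmul, smul_eq_mul]
  fin_cases i <;> rfl

theorem exponent_sub_nsmul (d e f d' e' f' : ℤ) (k : ℕ) :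
    exponent d e f - k • exponent d' e' f' =
      exponent (d - k * d') (e - k * e') (f - k * f') := by
  rw [← natCast_zsmul, exponent_sub_zsmul]

/-- The generating series `∑ tᵐ p⁻ᵐ q⁻ᵐ`. -/
noncomputable def stepSeries (K : Type*) [Field K] : HahnSeries Exponent K :=
  monomialSubst (exponent 1 (-1) (-1)) (exponent_pos_of_first _ _ one_pos)
    (PowerSeries.mk fun _ => 1)

theorem coeff_stepSeries (x y z : ℤ) : (stepSeries K).coeff (exponent x y z) =
    if y = -x ∧ z = -x ∧ 0 ≤ x then 1 else 0 := by
  have hv := exponent_pos_of_first (-1) (-1) one_pos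
  have hsmul : ∀ n : ℕ, n • exponent 1 (-1) (-1) = exponent n (-n) (-n) := fun n => by
    refine exponent_ext fun i => ?_
    rw [map_nsmul]
    fin_cases i <;> simp
  split_ifs with h
  · obtain ⟨rfl, rfl, hx⟩ := h
    lift x to ℕ using hx
    rw [← hsmul, stepSeries, coeff_monomialSubst_nsmul, PowerSeries.coeff_mk]
  · refine coeff_monomialSubst_of_ne _ hv _ fun n hn => h ?_
    rw [hsmul] at hn
    have h0 := congrArg (coord 0) hn
    have h1 := congrArg (coord 1) hn
    have h2 := congrArg (coord 2) hn
    simp only [coord_zero_exponent, coord_one_exponent, coord_two_exponent] at h0 h1 h2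
    omega

/-- The generating series `∑ u(l) b(j) (t / p)ˡ (t / q)ʲ (t / (p q))ᵐ`. -/
noncomputable def innerSeries (u b : ℕ → K) : HahnSeries Exponent K :=
  monomialSubst (exponent 1 (-1) 0) (exponent_pos_of_first _ _ one_pos) (PowerSeries.mk u) *
    (monomialSubst (exponent 1 0 (-1)) (exponent_pos_of_first _ _ one_pos) (PowerSeries.mk b) *
      stepSeries K)

theorem coeff_innerSeries (u b : ℕ → K) (x y z : ℤ) :
    (innerSeries u b).coeff (exponent x y z) =
      extendZero u (x + z) * (extendZero b (x + y) * if x + y + z ≤ 0 then 1 else 0) := by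
  have hb : ∀ x y z : ℤ,
      (monomialSubst (exponent 1 0 (-1)) (exponent_pos_of_first _ _ one_pos) (PowerSeries.mk b) *
        stepSeries K).coeff (exponent x y z) =
      extendZero b (x + y) * if z = -x ∧ y ≤ 0 then 1 else 0 := by
    intro x y z
    rw [coeff_monomialSubst_mul_eq_single _ _ _ _ _ (x + y), exponent_sub_zsmul,
      coeff_stepSeries]
    · congr 1
      refine if_congr ?_ rfl rfl
      omega
    · intro n hn
      rw [exponent_sub_nsmul, coeff_stepSeries, if_neg (by omega)]
  rw [innerSeries, coeff_monomialSubst_mul_eq_single _ _ _ _ _ (x + z), exponent_sub_zsmul, hb]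
  · congr 2
    · congr 1
      ring
    · refine if_congr ?_ rfl rfl
      omega
  · intro n hn
    rw [exponent_sub_nsmul, hb, if_neg (by omega), mul_zero]

/-- A Hahn series whose residues are the terms of the double convolution. -/
noncomputable def convolutionSeries (a b u v : ℕ → K) : HahnSeries Exponent K :=
  single (exponent 1 (-2) (-2)) 1 *
    (monomialSubst (exponent 0 1 0) (exponent_pos_of_second _ one_pos) (PowerSeries.mk a) *
      (monomialSubst (exponent 0 0 1) (exponent_pos_of_third one_pos) (PowerSeries.mk v) *
        innerSeries u b))

theorem coeff_convolutionSeries (a b u v : ℕ → K) (d : ℕ) :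
    (convolutionSeries a b u v).coeff (exponent d (-1) (-1)) =
      ∑ k ∈ Finset.Icc 1 d, a k * b (d - k) * ∑ l ∈ Finset.range k, u l * v (d - l) := by
  have hd : exponent d (-1) (-1) - exponent 1 (-2) (-2) = exponent (d - 1) 1 1 := by
    simpa using exponent_sub_zsmul d (-1) (-1) 1 (-2) (-2) 1
  have hinner : ∀ k : ℕ,
      (monomialSubst (exponent 0 0 1) (exponent_pos_of_third one_pos) (PowerSeries.mk v) *
        innerSeries u b).coeff (exponent (d - 1) (1 - k) 1) =
      ∑ w ∈ Finset.range (d + 1), v w * (extendZero u ((d : ℤ) - w) *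
        (extendZero b ((d : ℤ) - k) * if d + 1 ≤ k + w then 1 else 0)) := by
    intro k
    rw [coeff_monomialSubst_mul _ _ _ _ _ (Finset.range (d + 1))]
    · refine Finset.sum_congr rfl fun w _ => ?_
      rw [PowerSeries.coeff_mk, exponent_sub_nsmul, coeff_innerSeries,
        if_congr (Q := d + 1 ≤ k + w) (by omega) rfl rfl]
      congr 3
      · ring
      · congr 1
        ring
    · intro w hw
      rw [Finset.mem_range, not_lt] at hw
      rw [exponent_sub_nsmul, coeff_innerSeries, extendZero_of_neg u (by omega), zero_mul]
  rw [convolutionSeries, coeff_single_mul, one_mul, hd,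
    coeff_monomialSubst_mul _ _ _ _ _ (Finset.range (d + 1))]
  · have hsub : Finset.Icc 1 d ⊆ Finset.range (d + 1) := fun k hk => by
      simp only [Finset.mem_Icc, Finset.mem_range] at hk ⊢
      omega
    have hshift : ∀ k : ℕ, exponent (d - 1) 1 1 - k • exponent 0 1 0 =
        exponent (d - 1) (1 - k) 1 := fun k => by
      rw [exponent_sub_nsmul]
      simp
    simp only [hshift, hinner, PowerSeries.coeff_mk]
    rw [← Finset.sum_subset hsub]
    · refine Finset.sum_congr rfl fun k hk => ?_
      have hk := Finset.mem_Icc.1 hk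
      rw [← Finset.sum_range_reflect, mul_assoc]
      congr 1
      have hsub' : Finset.range k ⊆ Finset.range (d + 1) :=
        Finset.range_subset_range.2 (by omega)
      rw [Finset.mul_sum, ← Finset.sum_subset hsub']
      · refine Finset.sum_congr rfl fun l hl => ?_
        have hl := Finset.mem_range.1 hl
        rw [if_pos (by omega), extendZero_sub b hk.2, show d + 1 - 1 - l = d - l by omega,
          extendZero_sub u (by omega), Nat.sub_sub_self (by omega)]
        ring
      · intro l _ hl
        rw [Finset.mem_range] at hl
        rw [if_neg (by omega)]
        simp
    · intro k hk hk'
      obtain rfl : k = 0 := by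
        simp only [Finset.mem_Icc, Finset.mem_range] at hk hk'
        omega
      rw [Finset.sum_eq_zero, mul_zero]
      intro w hw
      rw [if_neg (by simpa using hw)]
      simp
  · intro k hk
    rw [Finset.mem_range, not_lt] at hk
    have hshift : exponent (d - 1) 1 1 - k • exponent 0 1 0 =
        exponent (d - 1) (1 - k) 1 := by
      rw [exponent_sub_nsmul]
      simp
    rw [hshift, hinner]
    refine Finset.sum_eq_zero fun w _ => ?_
    rw [extendZero_of_neg b (by omega)]
    simp

theorem holonomic_one : Holonomic fun _ : ℕ => (1 : K) :=
  ⟨1, fun i => if i = 0 then 1 else -1, ⟨0, by simp⟩, fun d => by simp [Finset.sum_range_succ]⟩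

theorem tame_of_holonomic [CharZero K] {a : ℕ → K} (ha : Holonomic a) (v : Exponent)
    (hv : 0 < v) : Tame (monomialSubst v hv (PowerSeries.mk a)) := by
  obtain ⟨n, c, hn, h⟩ := exists_differential_equation ha
  exact tame_monomialSubst v hv a n c hn h

end Convolution

end Holonomic

/-- If `a, b, u, v` are holonomic sequences over a field `K` of characteristic zero,
then so is `s(d) = Σ_{k=1}^{d} a(k)·b(d−k)·( Σ_{ℓ=0}^{k−1} u(ℓ)·v(d−ℓ) )`. -/
theorem holonomic_double_convolution {K : Type*} [Field K] [CharZero K]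
    (a b u v : ℕ → K) (ha : Holonomic a) (hb : Holonomic b)
    (hu : Holonomic u) (hv : Holonomic v) :
    Holonomic (fun d => ∑ k ∈ Finset.Icc 1 d,
      a k * b (d - k) * ∑ ℓ ∈ Finset.range k, u ℓ * v (d - ℓ)) := by
  have h : Holonomic.Tame (Holonomic.convolutionSeries a b u v) :=
    (Holonomic.tame_single _ _).mul ((Holonomic.tame_of_holonomic ha _ _).mul
      ((Holonomic.tame_of_holonomic hv _ _).mul ((Holonomic.tame_of_holonomic hu _ _).mul
        ((Holonomic.tame_of_holonomic hb _ _).mul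
          (Holonomic.tame_of_holonomic Holonomic.holonomic_one _ _)))))
  have hres := h.holonomic_residue
  simp only [Holonomic.coeff_convolutionSeries] at hres
  exact hres
end

section
/- (Theorem 4.4, explicit form) Let ħ be an indeterminate and K = ℂ(ħ) the field of rational functions in ħ. Let G = P/Q with P, Q ∈ ℂ[z], Q(0) ≠ 0 and P(0) = Q(0) (so that G is a rational function with G(0) = 1), and for an integer c write G(cħ) = P(cħ)/Q(cħ) ∈ K. Then the sequence n : ℕ_{≥1} → K defined by n(d) = (1/(d!·ħ^d)) · Σ_{k=1}^{d} (−1)^{d−k} · binom(d−1, k−1) · ∏_{i=1}^{d} G((k−i)ħ) is holonomic over K; that is, there exist an integer r ≥ 0 and polynomials p₀, …, p_r ∈ K[x], not all zero, such that Σ_{i=0}^{r} p_i(d)·n(d+i) = 0 for all d ≥ 1. -/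
/-- For a rational function `G = P/Q` and an integer `c`, the substitution
`G(cħ) = P(cħ)/Q(cħ)` as an element of the field `ℂ(ħ)` of rational functions. -/
noncomputable def Gsub (P Q : Polynomial ℂ) (c : ℤ) : RatFunc ℂ :=
  Polynomial.aeval ((c : RatFunc ℂ) * RatFunc.X) P /
    Polynomial.aeval ((c : RatFunc ℂ) * RatFunc.X) Q

/-- The 1-point function `n(d) = (1/(d!·ħ^d)) Σ_{k=1}^d (−1)^{d−k} C(d−1,k−1)
∏_{i=1}^d G((k−i)ħ)`, an element of `ℂ(ħ)`. -/
noncomputable def nseq (P Q : Polynomial ℂ) (d : ℕ) : RatFunc ℂ :=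
  (1 / ((d.factorial : RatFunc ℂ) * RatFunc.X ^ d)) *
    ∑ k ∈ Finset.Icc 1 d,
      (-1 : RatFunc ℂ) ^ (d - k) * ((d - 1).choose (k - 1) : RatFunc ℂ) *
        ∏ i ∈ Finset.Icc 1 d, Gsub P Q ((k : ℤ) - (i : ℤ))

section DFinite

open PowerSeries

variable {K : Type*} [Field K]

/-- The Euler derivation `X · d/dX` on formal power series. -/
noncomputable def eulerDerivation (K : Type*) [Field K] : Derivation K K⟦X⟧ K⟦X⟧ :=
  (X : K⟦X⟧) • d⁄dX K

theorem coeff_eulerDerivation (f : K⟦X⟧) (n : ℕ) :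
    coeff n (eulerDerivation K f) = n * coeff n f := by
  cases n with
  | zero => simp [eulerDerivation]
  | succ n => simp [eulerDerivation, coeff_succ_X_mul, coeff_derivative, mul_comm]

theorem coeff_iterate_eulerDerivation (f : K⟦X⟧) (i n : ℕ) :
    coeff n ((eulerDerivation K)^[i] f) = (n : K) ^ i * coeff n f := by
  induction i with
  | zero => simp
  | succ i ih => rw [Function.iterate_succ_apply', coeff_eulerDerivation, ih]; ring

theorem polynomial_smul_eq_coe_mul (p : Polynomial K) (f : K⟦X⟧) :
    p • f = (p : K⟦X⟧) * f := by
  simp [Algebra.smul_def, algebraMap_apply']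

theorem eulerDerivation_smul (p : Polynomial K) (f : K⟦X⟧) :
    eulerDerivation K (p • f) =
      p • eulerDerivation K f + (Polynomial.X * Polynomial.derivative p) • f := by
  simp only [polynomial_smul_eq_coe_mul, Derivation.leibniz, smul_eq_mul, eulerDerivation,
    Derivation.coe_smul, Pi.smul_apply, derivative_coe, Polynomial.coe_mul, Polynomial.coe_X]
  ring

/-- A power series is D-finite if, up to a nonzero polynomial factor, the Euler derivation preserves
some finitely generated `K[X]`-module containing the series. -/
def IsDFinite (f : K⟦X⟧) : Prop :=
  ∃ t : Polynomial K, t ≠ 0 ∧ ∃ W : Submodule (Polynomial K) K⟦X⟧,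
    W.FG ∧ f ∈ W ∧ ∀ w ∈ W, t • eulerDerivation K w ∈ W

theorem IsDFinite.mul {f g : K⟦X⟧} (hf : IsDFinite f) (hg : IsDFinite g) :
    IsDFinite (f * g) := by
  obtain ⟨s, hs, V, hV, hfV, hsV⟩ := hf
  obtain ⟨t, ht, W, hW, hgW, htW⟩ := hg
  refine ⟨s * t, mul_ne_zero hs ht, V * W, hV.mul hW, Submodule.mul_mem_mul hfV hgW, ?_⟩
  intro x hx
  refine Submodule.mul_induction_on hx (fun v hv w hw => ?_) fun x y hx hy => ?_
  · have h : (s * t) • eulerDerivation K (v * w) =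
        s • (v * (t • eulerDerivation K w)) + t • ((s • eulerDerivation K v) * w) := by
      simp only [polynomial_smul_eq_coe_mul, Derivation.leibniz, smul_eq_mul, Polynomial.coe_mul]
      ring
    rw [h]
    exact add_mem (Submodule.smul_mem _ _ (Submodule.mul_mem_mul hv (htW w hw)))
      (Submodule.smul_mem _ _ (Submodule.mul_mem_mul (hsV v hv) hw))
  · rw [map_add, smul_add]
    exact add_mem hx hy

theorem isDFinite_of_sum_smul_iterate_eq_zero {f : K⟦X⟧} {r : ℕ → Polynomial K} {N : ℕ}
    (hr : ∃ i < N, r i ≠ 0)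
    (h : ∑ i ∈ Finset.range N, r i • (eulerDerivation K)^[i] f = 0) : IsDFinite f := by
  induction N with
  | zero => simp at hr
  | succ N ih =>
    by_cases hN : r N = 0
    · rw [Finset.sum_range_succ, hN, zero_smul, add_zero] at h
      obtain ⟨i, hi, hri⟩ := hr
      refine ih ⟨i, ?_, hri⟩ h
      rcases Nat.lt_succ_iff_lt_or_eq.mp hi with hi | rfl
      · exact hi
      · exact absurd hN hri
    · set S : Set K⟦X⟧ := (fun i => (eulerDerivation K)^[i] f) '' Set.Iio N
      have hmem : ∀ i < N, (eulerDerivation K)^[i] f ∈ Submodule.span (Polynomial K) S :=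
        fun i hi => Submodule.subset_span ⟨i, hi, rfl⟩
      have htop : r N • (eulerDerivation K)^[N] f ∈ Submodule.span (Polynomial K) S := by
        rw [Finset.sum_range_succ, add_comm] at h
        rw [eq_neg_of_add_eq_zero_left h]
        exact neg_mem (sum_mem fun i hi => Submodule.smul_mem _ _ (hmem i (Finset.mem_range.mp hi)))
      rcases Nat.eq_zero_or_pos N with rfl | hpos
      · refine ⟨r 0, hN, ⊥, Submodule.fg_bot, ?_, ?_⟩
        · have : (r 0 : K⟦X⟧) * f = 0 := by simpa [polynomial_smul_eq_coe_mul] using h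
          simpa [hN] using this
        · intro w hw
          simp [(Submodule.mem_bot _).mp hw]
      · refine ⟨r N, hN, Submodule.span (Polynomial K) S,
          Submodule.fg_span ((Set.finite_Iio N).image _), hmem 0 hpos, ?_⟩
        intro w hw
        induction hw using Submodule.span_induction with
        | mem x hx =>
          obtain ⟨i, hi, rfl⟩ := hx
          simp only [← Function.iterate_succ_apply']
          rcases Nat.lt_or_ge (i + 1) N with hlt | hge
          · exact Submodule.smul_mem _ _ (hmem _ hlt)
          · rwa [show i.succ = N from le_antisymm hi hge]
        | zero => simp
        | add x y _ _ hx hy =>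
          rw [map_add, smul_add]
          exact add_mem hx hy
        | smul a x hx ih =>
          rw [eulerDerivation_smul, smul_add, smul_comm]
          exact add_mem (Submodule.smul_mem _ _ ih)
            (Submodule.smul_mem _ _ (Submodule.smul_mem _ _ hx))

theorem IsDFinite.exists_sum_smul_iterate_eq_zero {f : K⟦X⟧} (hf : IsDFinite f) :
    ∃ (N : ℕ) (r : ℕ → Polynomial K), (∃ i < N, r i ≠ 0) ∧
      ∑ i ∈ Finset.range N, r i • (eulerDerivation K)^[i] f = 0 := by
  obtain ⟨t, ht, W, hW, hfW, htW⟩ := hf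
  have hmem : ∀ i, t ^ i • (eulerDerivation K)^[i] f ∈ W := by
    intro i
    induction i with
    | zero => simpa using hfW
    | succ i ih =>
      have h := sub_mem (htW _ ih)
        (W.smul_mem ((i : Polynomial K) * Polynomial.X * Polynomial.derivative t) ih)
      convert h using 1
      rw [eulerDerivation_smul, Function.iterate_succ_apply', Polynomial.derivative_pow]
      cases i with
      | zero => simp
      | succ i =>
        simp only [Nat.add_sub_cancel, map_natCast]
        module
  have : Module.Finite (Polynomial K) W := Module.Finite.iff_fg.mpr hW
  have hdep := Module.Finite.not_linearIndependent_of_infinite (R := Polynomial K)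
    (fun i : ℕ => (⟨_, hmem i⟩ : W))
  rw [linearIndependent_iff] at hdep
  push Not at hdep
  obtain ⟨l, hl, hl0⟩ := hdep
  obtain ⟨i, hi⟩ := Finsupp.ne_iff.mp hl0
  obtain ⟨N, hN⟩ := Finset.exists_nat_subset_range l.support
  refine ⟨N, fun i => l i * t ^ i, ⟨i, Finset.mem_range.mp (hN (by simpa using hi)),
    mul_ne_zero hi (pow_ne_zero _ ht)⟩, ?_⟩
  rw [Finsupp.linearCombination_apply, Finsupp.sum_of_support_subset _ hN _ (by simp)] at hl
  simpa [mul_smul] using congrArg (Subtype.val) hl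

/-- The coefficients of a D-finite series satisfy a linear recurrence with polynomial
coefficients. -/
theorem IsDFinite.exists_recurrence {f : K⟦X⟧} (hf : IsDFinite f) :
    ∃ (S : ℕ) (p : ℕ → Polynomial K), (∃ i ≤ S, p i ≠ 0) ∧
      ∀ n : ℕ, ∑ i ∈ Finset.range (S + 1), (p i).eval (n : K) * coeff (n + i) f = 0 := by
  obtain ⟨N, r, ⟨i₀, hi₀, hr⟩, h⟩ := hf.exists_sum_smul_iterate_eq_zero
  set S := (Finset.range N).sup fun i => (r i).natDegree
  have hdeg : ∀ i < N, (r i).natDegree ≤ S := fun i hi =>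
    Finset.le_sup (f := fun i => (r i).natDegree) (Finset.mem_range.mpr hi)
  set p : ℕ → Polynomial K := fun j =>
    ∑ i ∈ Finset.range N, Polynomial.monomial i ((r i).coeff (S - j)) with hp
  refine ⟨S, fun j => (p j).comp (Polynomial.X + Polynomial.C (j : K)),
    ⟨S - (r i₀).natDegree, Nat.sub_le _ _, ?_⟩, ?_⟩
  · intro h0
    rw [Polynomial.comp_eq_zero_iff] at h0
    rcases h0 with h0 | ⟨-, h0⟩
    · have := congrArg (Polynomial.coeff · i₀) h0
      simp only [hp, Polynomial.finsetSum_coeff, Polynomial.coeff_monomial,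
        Nat.sub_sub_self (hdeg i₀ hi₀), Finset.sum_ite_eq', Finset.mem_range, hi₀, if_true,
        Polynomial.coeff_natDegree, Polynomial.coeff_zero] at this
      exact hr (Polynomial.leadingCoeff_eq_zero.mp this)
    · have := congrArg (Polynomial.coeff · 1) h0
      simp at this
  · intro n
    have hn := congrArg (coeff (n + S)) h
    rw [map_sum, map_zero] at hn
    rw [← hn]
    have hterm : ∀ i ∈ Finset.range N, coeff (n + S) (r i • (eulerDerivation K)^[i] f) =
        ∑ j ∈ Finset.range (S + 1),
          (r i).coeff (S - j) * ((n + j : ℕ) : K) ^ i * coeff (n + j) f := by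
      intro i hi
      rw [← Finset.sum_range_reflect, polynomial_smul_eq_coe_mul, coeff_mul,
        Finset.Nat.sum_antidiagonal_eq_sum_range_succ_mk]
      symm
      refine Finset.sum_subset_zero_on_sdiff
        (Finset.range_subset_range.mpr (by omega)) ?_ ?_
      · intro j hj
        simp only [Finset.mem_sdiff, Finset.mem_range, not_lt] at hj
        rw [Polynomial.coeff_coe, Polynomial.coeff_eq_zero_of_natDegree_lt, zero_mul]
        exact lt_of_le_of_lt (hdeg i (Finset.mem_range.mp hi)) hj.2
      · intro j hj
        have hj' := Finset.mem_range.mp hj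
        rw [coeff_iterate_eulerDerivation, Polynomial.coeff_coe,
          show S - (S + 1 - 1 - j) = j by omega, show n + (S + 1 - 1 - j) = n + S - j by omega]
        ring
    rw [Finset.sum_congr rfl hterm, Finset.sum_comm]
    refine Finset.sum_congr rfl fun j _ => ?_
    rw [Polynomial.eval_comp, hp, Polynomial.eval_finsetSum, Finset.sum_mul]
    refine Finset.sum_congr rfl fun i _ => ?_
    simp [Polynomial.eval_monomial]

/-- The generating series of a hypergeometric sequence is D-finite. -/
theorem isDFinite_mk_of_hypergeometric {w : ℕ → K} {p q : Polynomial K} (hq : q ≠ 0)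
    (hq0 : q.eval 0 = 0) (h : ∀ n : ℕ, q.eval ((n + 1 : ℕ) : K) * w (n + 1) = p.eval (n : K) * w n) :
    IsDFinite (PowerSeries.mk w) := by
  set N := max p.natDegree q.natDegree + 1 with hN
  refine isDFinite_of_sum_smul_iterate_eq_zero (N := N)
    (r := fun i => Polynomial.C (q.coeff i) - Polynomial.X * Polynomial.C (p.coeff i))
    ⟨q.natDegree, by omega, ?_⟩ ?_
  · intro h0
    have := congrArg (Polynomial.coeff · 0) h0
    simp [hq] at this
  · have key : ∀ (g : Polynomial K), g.natDegree < N → ∀ n : ℕ,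
        coeff n (∑ i ∈ Finset.range N,
          Polynomial.C (g.coeff i) • (eulerDerivation K)^[i] (PowerSeries.mk w)) =
          g.eval (n : K) * w n := by
      intro g hg n
      rw [Polynomial.eval_eq_sum_range' hg, Finset.sum_mul, map_sum]
      refine Finset.sum_congr rfl fun i _ => ?_
      rw [polynomial_smul_eq_coe_mul, Polynomial.coe_C, coeff_C_mul,
        coeff_iterate_eulerDerivation, coeff_mk, mul_assoc]
    simp only [sub_smul, mul_smul, Finset.sum_sub_distrib, ← Finset.smul_sum]
    ext n
    rw [map_sub, key q (by omega), polynomial_smul_eq_coe_mul, Polynomial.coe_X, map_zero]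
    cases n with
    | zero => simp [hq0]
    | succ n => rw [coeff_succ_X_mul, key p (by omega), h, sub_self]

end DFinite

section OnePoint

open Polynomial

theorem aeval_intCast_mul_X_ne_zero {Q : ℂ[X]} (hQ : Q.coeff 0 ≠ 0) (c : ℤ) :
    aeval ((c : RatFunc ℂ) * RatFunc.X) Q ≠ 0 := by
  have h : aeval ((c : RatFunc ℂ) * RatFunc.X) Q =
      algebraMap ℂ[X] (RatFunc ℂ) (Q.comp (C (c : ℂ) * X)) := by
    rw [Polynomial.comp_eq_aeval, ← Polynomial.aeval_algebraMap_apply]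
    simp
  rw [h, Ne, FaithfulSMul.algebraMap_eq_zero_iff]
  intro h0
  have := congrArg (Polynomial.eval 0) h0
  simp [Polynomial.eval_comp, ← Polynomial.coeff_zero_eq_eval_zero, hQ] at this

theorem Gsub_zero {P Q : ℂ[X]} (hQ : Q.coeff 0 ≠ 0) (hPQ : P.coeff 0 = Q.coeff 0) :
    Gsub P Q 0 = 1 := by
  have hQ' := aeval_intCast_mul_X_ne_zero hQ 0
  simp only [Gsub, Int.cast_zero, zero_mul, ← Polynomial.coeff_zero_eq_aeval_zero', hPQ] at hQ' ⊢
  exact div_self hQ'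

/-- The polynomial over `ℂ(ħ)` in the variable `x` obtained from `P(z)` by substituting
`z = (a * x) * ħ`. -/
noncomputable def scaledPolynomial (P : ℂ[X]) (a : ℤ) : (RatFunc ℂ)[X] :=
  (P.map (algebraMap ℂ (RatFunc ℂ))).comp (C ((a : RatFunc ℂ) * RatFunc.X) * X)

theorem eval_scaledPolynomial (P : ℂ[X]) (a c : ℤ) :
    (scaledPolynomial P a).eval (c : RatFunc ℂ) =
      aeval (((a * c : ℤ) : RatFunc ℂ) * RatFunc.X) P := by
  rw [scaledPolynomial, eval_comp, eval_map_algebraMap]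
  congr 2
  simp
  ring

/-- The hypergeometric factor `a ^ n * ∏_{j = 1}^n G(a j ħ) / n!`. -/
noncomputable def hypergeometricFactor (P Q : ℂ[X]) (a : ℤ) (n : ℕ) : RatFunc ℂ :=
  (a : RatFunc ℂ) ^ n * (∏ j ∈ Finset.range n, Gsub P Q (a * (j + 1))) / n.factorial

theorem isDFinite_hypergeometricFactor {P Q : ℂ[X]} (hQ : Q.coeff 0 ≠ 0) (a : ℤ) :
    IsDFinite (PowerSeries.mk (hypergeometricFactor P Q a)) := by
  refine isDFinite_mk_of_hypergeometric (q := X * scaledPolynomial Q a)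
    (p := C (a : RatFunc ℂ) * (scaledPolynomial P a).comp (X + 1)) ?_ (by simp) ?_
  · refine mul_ne_zero X_ne_zero fun h => ?_
    have := eval_scaledPolynomial Q a 0
    rw [h, eval_zero] at this
    exact aeval_intCast_mul_X_ne_zero hQ _ this.symm
  · intro n
    have hq := eval_scaledPolynomial Q a (n + 1)
    have hp := eval_scaledPolynomial P a (n + 1)
    have hne := aeval_intCast_mul_X_ne_zero hQ (a * (n + 1))
    have hfac : (n.factorial : RatFunc ℂ) ≠ 0 := Nat.cast_ne_zero.mpr n.factorial_ne_zero
    have hsucc : (n : RatFunc ℂ) + 1 ≠ 0 := Nat.cast_add_one_ne_zero n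
    rw [Int.cast_add, Int.cast_natCast, Int.cast_one] at hq hp
    simp only [eval_mul, eval_X, eval_C, eval_comp, eval_add, eval_one, Nat.cast_add, Nat.cast_one,
      hq, hp, hypergeometricFactor, Finset.prod_range_succ, Nat.factorial_succ, Nat.cast_mul, Gsub]
    field_simp
    ring

theorem prod_Icc_Gsub {P Q : ℂ[X]} (hG : Gsub P Q 0 = 1) (a b : ℕ) :
    ∏ i ∈ Finset.Icc 1 (a + b + 1), Gsub P Q (((a + 1 : ℕ) : ℤ) - i) =
      (∏ j ∈ Finset.range a, Gsub P Q (1 * (j + 1))) *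
        ∏ j ∈ Finset.range b, Gsub P Q (-1 * (j + 1)) := by
  rw [← Finset.Ico_add_one_right_eq_Icc, Finset.prod_Ico_eq_prod_range,
    show a + b + 1 + 1 - 1 = a + (b + 1) by omega, Finset.prod_range_add,
    Finset.prod_range_succ', ← Finset.prod_range_reflect]
  congr 1
  · refine Finset.prod_congr rfl fun i hi => ?_
    have := Finset.mem_range.mp hi
    congr 1
    omega
  · rw [show ((a + 1 : ℕ) : ℤ) - ((1 + (a + 0) : ℕ) : ℤ) = 0 by push_cast; ring, hG, mul_one]
    refine Finset.prod_congr rfl fun i _ => ?_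
    congr 1
    push_cast
    ring

theorem coeff_mul_hypergeometricFactor {P Q : ℂ[X]} (hG : Gsub P Q 0 = 1) (m : ℕ) :
    PowerSeries.coeff m (PowerSeries.mk (hypergeometricFactor P Q 1) *
      PowerSeries.mk (hypergeometricFactor P Q (-1))) =
      ((m : RatFunc ℂ) + 1) * RatFunc.X ^ (m + 1) * nseq P Q (m + 1) := by
  have hX : (RatFunc.X : RatFunc ℂ) ≠ 0 := RatFunc.X_ne_zero
  have hm : (m : RatFunc ℂ) + 1 ≠ 0 := Nat.cast_add_one_ne_zero m
  have hfac (n : ℕ) : (n.factorial : RatFunc ℂ) ≠ 0 := Nat.cast_ne_zero.mpr n.factorial_ne_zero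
  have hscale (s : RatFunc ℂ) : ((m : RatFunc ℂ) + 1) * RatFunc.X ^ (m + 1) *
      (1 / (((m + 1).factorial : RatFunc ℂ) * RatFunc.X ^ (m + 1)) * s) = s / (m.factorial : RatFunc ℂ) := by
    have := hfac m
    rw [Nat.factorial_succ]
    push_cast
    field_simp
  rw [nseq, hscale, PowerSeries.coeff_mul, Finset.Nat.sum_antidiagonal_eq_sum_range_succ_mk,
    ← Finset.Ico_add_one_right_eq_Icc, Finset.sum_Ico_eq_sum_range, Finset.sum_div]
  refine Finset.sum_congr rfl fun a ha => ?_
  obtain ⟨b, rfl⟩ := Nat.exists_eq_add_of_le (Nat.lt_succ_iff.mp (Finset.mem_range.mp ha))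
  have hchoose : ((a + b).choose a : RatFunc ℂ) * a.factorial * b.factorial =
      (a + b).factorial := by
    rw [Nat.choose_symm_add]
    exact_mod_cast Nat.add_choose_mul_factorial_mul_factorial a b
  have ha' := hfac a
  have hb' := hfac b
  have hab := hfac (a + b)
  rw [add_comm 1 a, Finset.Ico_add_one_right_eq_Icc, prod_Icc_Gsub hG, show a + b + 1 - (a + 1) = b by omega,
    show a + b - a = b by omega, Nat.add_sub_cancel, Nat.add_sub_cancel, PowerSeries.coeff_mk,
    PowerSeries.coeff_mk, hypergeometricFactor, hypergeometricFactor, Int.cast_one, one_pow,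
    one_mul, Int.cast_neg, Int.cast_one, div_mul_div_comm, div_eq_div_iff (mul_ne_zero ha' hb') hab,
    ← hchoose]
  ring

end OnePoint

/-- Theorem 4.4: for a rational function `G = P/Q` with `G(0) = 1`, the 1-point function
of the partition function with weights `q = (1,0,0,…)` is holonomic over `ℂ(ħ)`. -/
theorem one_point_holonomic_simple (P Q : Polynomial ℂ)
    (hQ : Q.coeff 0 ≠ 0) (hPQ : P.coeff 0 = Q.coeff 0) :
    ∃ (r : ℕ) (p : ℕ → Polynomial (RatFunc ℂ)),
      (∃ i ≤ r, p i ≠ 0) ∧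
      ∀ d : ℕ, 1 ≤ d →
        ∑ i ∈ Finset.range (r + 1), (p i).eval (d : RatFunc ℂ) * nseq P Q (d + i) = 0 := by
  obtain ⟨r, p, ⟨i, hi, hpi⟩, hrec⟩ :=
    ((isDFinite_hypergeometricFactor (P := P) hQ 1).mul
      (isDFinite_hypergeometricFactor hQ (-1))).exists_recurrence
  have hX : (RatFunc.X : RatFunc ℂ) ≠ 0 := RatFunc.X_ne_zero
  refine ⟨r, fun i => (p i).comp (Polynomial.X - Polynomial.C 1) *
    (Polynomial.X + Polynomial.C (i : RatFunc ℂ)) * Polynomial.C (RatFunc.X ^ (i + 1)),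
    ⟨i, hi, ?_⟩, ?_⟩
  · refine mul_ne_zero (mul_ne_zero ?_ (Polynomial.X_add_C_ne_zero _))
      (Polynomial.C_ne_zero.mpr (pow_ne_zero _ hX))
    intro h0
    rcases Polynomial.comp_eq_zero_iff.mp h0 with h0 | ⟨-, h0⟩
    · exact hpi h0
    · simpa using congrArg (Polynomial.coeff · 1) h0
  · intro d hd
    obtain ⟨m, rfl⟩ := Nat.exists_eq_add_of_le' hd
    refine (mul_eq_zero.mp ?_).resolve_left (pow_ne_zero m hX)
    rw [← hrec m, Finset.mul_sum]
    refine Finset.sum_congr rfl fun i _ => ?_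
    rw [coeff_mul_hypergeometricFactor (Gsub_zero hQ hPQ), show m + 1 + i = m + i + 1 by ring]
    simp only [Polynomial.eval_mul, Polynomial.eval_comp, Polynomial.eval_sub, Polynomial.eval_add,
      Polynomial.eval_X, Polynomial.eval_C]
    push_cast
    rw [add_sub_cancel_right]
    ring
end

section
/- (No 1-point recursion for simple Hurwitz numbers) For integers d ≥ 1 and m ≥ 0, let N(d, m) be the number of m-tuples (τ₁, …, τ_m) of transpositions in S_d with τ₁∘τ₂∘⋯∘τ_m = (1 2 … d), and for g ≥ 0, d ≥ 1 define the 1-part simple Hurwitz number h_g(d) = N(d, d+2g−1)/(d+2g−1)!. Then the family h_g(d) does not satisfy a 1-point recursion: there do NOT exist integers I, J ≥ 0 and complex polynomials p_{ij} for 0 ≤ i ≤ I and 0 ≤ j ≤ J, not all zero, such that Σ_{i=0}^{I} Σ_{j=0}^{J} p_{ij}(d)·h_{g−i}(d−j) = 0 for all g ≥ I and d ≥ J+1. -/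
/-- `Nfact d m` is the number of `m`-tuples `(τ₁, …, τ_m)` of transpositions in the
symmetric group on `d` letters with `τ₁ ∘ τ₂ ∘ ⋯ ∘ τ_m` equal to the standard `d`-cycle. -/
noncomputable def Nfact (d m : ℕ) : ℕ :=
  Nat.card {τ : Fin m → Equiv.Perm (Fin d) //
    (∀ i, (τ i).IsSwap) ∧ (List.ofFn τ).prod = finRotate d}

/-- The 1-part simple Hurwitz number `h_g(d) = N(d, d+2g−1)/(d+2g−1)!`. -/
noncomputable def hurwitz (g d : ℕ) : ℂ :=
  (Nfact d (d + 2 * g - 1) : ℂ) / ((d + 2 * g - 1).factorial : ℂ)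

open Asymptotics Filter Equiv

/-- The number of transpositions of `d` letters. -/
lemma Nat.card_isSwap {d : ℕ} (hd : 2 ≤ d) :
    Nat.card {τ : Perm (Fin d) // τ.IsSwap} = d.choose 2 := by
  have h := Perm.card_of_cycleType_singleton (α := Fin d) le_rfl (by simpa using hd)
  classical
  rw [Nat.card_eq_fintype_card, Fintype.card_subtype]
  simp_rw [Perm.isSwap_iff_cycleType]
  convert h using 1
  simp

lemma Nfact_le {d : ℕ} (hd : 2 ≤ d) (m : ℕ) : Nfact d m ≤ d.choose 2 ^ m := by
  have h : Nat.card (Fin m → {τ : Perm (Fin d) // τ.IsSwap}) = d.choose 2 ^ m := by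
    rw [Nat.card_fun, Nat.card_isSwap hd, Nat.card_eq_fintype_card, Fintype.card_fin]
  rw [← h]
  refine Nat.card_le_card_of_injective (fun t i => ⟨t.1 i, t.2.1 i⟩) fun s t hst => ?_
  ext1
  funext i
  exact congrArg Subtype.val (congrFun hst i)

lemma exists_swaps_prod_of_even {d : ℕ} (hd : 2 ≤ d) :
    ∃ L : ℕ, ∀ σ : Perm (Fin d), Perm.sign σ = 1 →
      ∃ t : Fin (2 * L) → Perm (Fin d), (∀ i, (t i).IsSwap) ∧ (List.ofFn t).prod = σ := by
  have key : ∀ σ : Perm (Fin d), ∃ l : List (Perm (Fin d)),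
      l.prod = σ ∧ ∀ g ∈ l, g.IsSwap := fun σ =>
    let ⟨l, hl⟩ := (Perm.truncSwapFactors σ).out
    ⟨l, hl⟩
  choose l hl hs using key
  refine ⟨∑ σ, (l σ).length, fun σ hσ => ?_⟩
  have hle : (l σ).length ≤ ∑ σ, (l σ).length :=
    Finset.single_le_sum (f := fun σ => (l σ).length) (fun _ _ => Nat.zero_le _)
      (Finset.mem_univ σ)
  have hev : Even (l σ).length := by
    rw [← hl σ, Perm.sign_prod_list_swap (hs σ)] at hσ
    by_contra h
    rw [(Nat.not_even_iff_odd.1 h).neg_one_pow] at hσ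
    exact absurd hσ (by decide)
  obtain ⟨a, ha⟩ := hev
  set S := ∑ σ, (l σ).length
  have hne : (⟨0, by omega⟩ : Fin d) ≠ ⟨1, by omega⟩ := by simp
  set u : Perm (Fin d) := Equiv.swap ⟨0, by omega⟩ ⟨1, by omega⟩
  have hu : u.IsSwap := ⟨_, _, hne, rfl⟩
  let l' := l σ ++ List.replicate (2 * (S - a)) u
  have hlen : l'.length = 2 * S := by simp [l']; omega
  have hprod : l'.prod = σ := by
    simp [l', hl, pow_mul, pow_two, u]
  have hsw : ∀ g ∈ l', g.IsSwap := by
    intro g hg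
    rcases List.mem_append.1 hg with h | h
    · exact hs σ g h
    · rw [List.eq_of_mem_replicate h]; exact hu
  clear_value l'
  rw [← hlen]
  exact ⟨l'.get, fun i => hsw _ (List.get_mem _ _), by rw [List.ofFn_get]; exact hprod⟩

lemma exists_le_Nfact {d : ℕ} (hd : 2 ≤ d) :
    ∃ L : ℕ, ∀ a : ℕ, d.choose 2 ^ (d - 1 + 2 * a) ≤ Nfact d (d - 1 + 2 * a + 2 * L) := by
  obtain ⟨L, hL⟩ := exists_swaps_prod_of_even hd
  refine ⟨L, fun a => ?_⟩
  set m := d - 1 + 2 * a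
  have h : Nat.card (Fin m → {τ : Perm (Fin d) // τ.IsSwap}) = d.choose 2 ^ m := by
    rw [Nat.card_fun, Nat.card_isSwap hd, Nat.card_eq_fintype_card, Fintype.card_fin]
  rw [← h]
  have hsign : ∀ s : Fin m → {τ : Perm (Fin d) // τ.IsSwap},
      Perm.sign ((List.ofFn fun i => (s i).1).prod⁻¹ * finRotate d) = 1 := by
    intro s
    rw [map_mul, Perm.sign_inv, sign_finRotate, Perm.sign_prod_list_swap, List.length_ofFn,
      ← pow_add]
    · exact Even.neg_one_pow ⟨d - 1 + a, by omega⟩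
    · intro g hg
      obtain ⟨i, rfl⟩ := (List.mem_ofFn' _ _).1 hg
      exact (s i).2
  choose t ht htp using fun s => hL _ (hsign s)
  refine Nat.card_le_card_of_injective
    (fun s => ⟨Fin.append (fun i => (s i).1) (t s), fun i => ?_, ?_⟩) fun s s' hss => ?_
  · refine Fin.addCases (fun i => ?_) (fun i => ?_) i
    · rw [Fin.append_left]; exact (s i).2
    · rw [Fin.append_right]; exact ht s i
  · rw [List.ofFn_fin_append, List.prod_append, htp, mul_inv_cancel_left]
  · funext i
    have := congrFun (congrArg Subtype.val hss) (Fin.castAdd _ i)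
    simp only [Fin.append_left] at this
    exact Subtype.ext this

lemma hurwitz_isTheta {d : ℕ} (hd : 2 ≤ d) (a : ℕ) :
    (fun g : ℕ => hurwitz (g + a) d) =Θ[atTop]
      fun g : ℕ => ((d.choose 2 : ℝ) ^ 2) ^ g / ((2 * g + (d - 1 + 2 * a)).factorial : ℝ) := by
  have hb : (0 : ℝ) < d.choose 2 := by exact_mod_cast Nat.choose_pos hd
  have hN : ∀ g, ‖hurwitz (g + a) d‖ = (Nfact d (2 * g + (d - 1 + 2 * a)) : ℝ) /
      ((2 * g + (d - 1 + 2 * a)).factorial : ℝ) := by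
    intro g
    rw [hurwitz, norm_div, Complex.norm_natCast, Complex.norm_natCast,
      show d + 2 * (g + a) - 1 = 2 * g + (d - 1 + 2 * a) by omega]
  have hn : ∀ g, ‖((d.choose 2 : ℝ) ^ 2) ^ g / ((2 * g + (d - 1 + 2 * a)).factorial : ℝ)‖ =
      ((d.choose 2 : ℝ) ^ 2) ^ g / ((2 * g + (d - 1 + 2 * a)).factorial : ℝ) := fun g =>
    Real.norm_of_nonneg (by positivity)
  constructor
  · refine IsBigO.of_bound ((d.choose 2 : ℝ) ^ (d - 1 + 2 * a)) (Eventually.of_forall fun g => ?_)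
    rw [hN, hn, ← mul_div_assoc]
    gcongr
    rw [← pow_mul, ← pow_add, add_comm]
    exact_mod_cast Nfact_le hd _
  · obtain ⟨L, hL⟩ := exists_le_Nfact hd
    refine IsBigO.of_bound ((d.choose 2 : ℝ) ^ (2 * L)) ?_
    filter_upwards [eventually_ge_atTop L] with g hg
    rw [hN, hn, ← mul_div_assoc]
    gcongr
    have h1 := hL (a + (g - L))
    rw [show d - 1 + 2 * (a + (g - L)) + 2 * L = 2 * g + (d - 1 + 2 * a) by omega] at h1
    have h2 : (d.choose 2 : ℝ) ^ (d - 1 + 2 * (a + (g - L))) ≤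
        Nfact d (2 * g + (d - 1 + 2 * a)) := by exact_mod_cast h1
    have hb1 : (1 : ℝ) ≤ d.choose 2 := by exact_mod_cast Nat.choose_pos hd
    calc ((d.choose 2 : ℝ) ^ 2) ^ g
        ≤ (d.choose 2 : ℝ) ^ (2 * L) * (d.choose 2 : ℝ) ^ (d - 1 + 2 * (a + (g - L))) := by
          rw [← pow_mul, ← pow_add]
          exact pow_le_pow_right₀ hb1 (by omega)
      _ ≤ _ := by gcongr

lemma isLittleO_pow_div_factorial_of_lt_right (b : ℝ) {e e' : ℕ} (h : e < e') :
    (fun g : ℕ => b ^ g / ((2 * g + e').factorial : ℝ)) =o[atTop]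
      fun g : ℕ => b ^ g / ((2 * g + e).factorial : ℝ) := by
  rw [isLittleO_iff]
  intro c hc
  filter_upwards [eventually_ge_atTop ⌈c⁻¹⌉₊] with g hg
  have hg' : c⁻¹ ≤ g := Nat.ceil_le.1 hg
  have hf : ((2 * g + e).factorial : ℝ) * (g + 1) ≤ (2 * g + e').factorial := by
    have h1 : (2 * g + e).factorial * (g + 1) ≤ (2 * g + e').factorial :=
      calc (2 * g + e).factorial * (g + 1) ≤ (2 * g + e + 1) * (2 * g + e).factorial := by
            rw [mul_comm]; gcongr; omega
        _ = (2 * g + e + 1).factorial := (Nat.factorial_succ _).symm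
        _ ≤ _ := Nat.factorial_le (by omega)
    exact_mod_cast h1
  rw [norm_div, norm_div, RCLike.norm_natCast, RCLike.norm_natCast, ← mul_div_assoc,
    div_le_div_iff₀ (by positivity) (by positivity)]
  have hc1 : 1 ≤ c * (g + 1) := by
    rw [inv_le_iff_one_le_mul₀ hc] at hg'
    nlinarith
  calc ‖b ^ g‖ * ((2 * g + e).factorial : ℝ)
      ≤ ‖b ^ g‖ * ((2 * g + e).factorial : ℝ) * (c * (g + 1)) :=
        le_mul_of_one_le_right (by positivity) hc1
    _ = c * ‖b ^ g‖ * (((2 * g + e).factorial : ℝ) * (g + 1)) := by ring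
    _ ≤ _ := by gcongr

lemma isLittleO_pow_div_factorial_of_lt_left {b b' : ℝ} (hb : 0 ≤ b) (h : b < b') (e e' : ℕ) :
    (fun g : ℕ => b ^ g / ((2 * g + e').factorial : ℝ)) =o[atTop]
      fun g : ℕ => b' ^ g / ((2 * g + e).factorial : ℝ) := by
  have hb' : 0 < b' := hb.trans_lt h
  have hmain : (fun g : ℕ => (g : ℝ) ^ e * b ^ g) =o[atTop] fun g : ℕ => b' ^ g :=
    isLittleO_pow_const_mul_const_pow_const_pow_of_norm_lt e (by rwa [Real.norm_of_nonneg hb])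
  have hmul := hmain.mul_isBigO
    (isBigO_refl (fun g : ℕ => (((2 * g + e).factorial : ℝ))⁻¹) atTop)
  simp only [← div_eq_mul_inv] at hmul
  refine IsBigO.trans_isLittleO ?_ hmul
  refine IsBigO.of_bound (((2 : ℝ) + e) ^ e) ?_
  filter_upwards [eventually_ge_atTop 1] with g hg
  have hf : ((2 * g + e).factorial : ℝ) ≤ (2 + e) ^ e * g ^ e * (2 * g + e').factorial := by
    have h1 : (2 * g + e).factorial ≤ (2 + e) ^ e * g ^ e * (2 * g + e').factorial :=
      calc (2 * g + e).factorial ≤ (2 * g).factorial * (2 * g + e) ^ e := by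
            rw [← Nat.factorial_mul_ascFactorial]
            gcongr
            exact Nat.ascFactorial_le_pow_add _ _
        _ ≤ (2 * g + e').factorial * ((2 + e) * g) ^ e := by
            gcongr
            · omega
            · nlinarith
        _ = _ := by rw [mul_pow]; ring
    exact_mod_cast h1
  rw [Real.norm_of_nonneg (by positivity), Real.norm_of_nonneg (by positivity), ← mul_div_assoc,
    div_le_div_iff₀ (by positivity) (by positivity)]
  calc b ^ g * ((2 * g + e).factorial : ℝ)
      ≤ b ^ g * ((2 + e) ^ e * g ^ e * (2 * g + e').factorial) := by gcongr
    _ = _ := by ring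

/-- Functions of pairwise distinct orders of growth are linearly independent. -/
lemma eq_zero_of_sum_eq_zero_of_isLittleO {ι κ 𝕜 : Type*} [LinearOrder κ] [NormedField 𝕜]
    (s : Finset ι) (f : ι → ℕ → 𝕜) (key : ι → κ) (hkey : Function.Injective key)
    (hf : ∀ p ∈ s, ∀ q ∈ s, key p < key q → f p =o[atTop] f q)
    (h0 : ∀ p ∈ s, ∃ᶠ n in atTop, f p n ≠ 0)
    (a : ι → 𝕜) (hsum : ∀ n, ∑ p ∈ s, a p * f p n = 0) : ∀ p ∈ s, a p = 0 := by
  classical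
  by_contra! hne
  obtain ⟨p, hp, hap⟩ := hne
  obtain ⟨q, hq, hmax⟩ := (s.filter (a · ≠ 0)).exists_max_image key ⟨p, by simp [hp, hap]⟩
  rw [Finset.mem_filter] at hq
  have ho : (∑ p ∈ s.erase q, fun n => a p * f p n) =o[atTop] f q := by
    refine IsLittleO.sum fun r hr => ?_
    rw [Finset.mem_erase] at hr
    by_cases har : a r = 0
    · simp [har]
    · have hle := hmax r (by simp [hr.2, har])
      exact (hf r hr.2 q hq.1 (hle.lt_of_ne fun h => hr.1 (hkey h))).const_mul_left _
  have heq : (∑ p ∈ s.erase q, fun n => a p * f p n) = fun n => -a q * f q n := by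
    funext n
    have := hsum n
    rw [← Finset.add_sum_erase s _ hq.1] at this
    rw [Finset.sum_apply]
    linear_combination this
  rw [heq, isLittleO_const_mul_left_iff (neg_ne_zero.2 hq.2)] at ho
  exact isLittleO_irrefl (h0 q hq.1) ho

lemma hurwitz_isLittleO {d d' a a' : ℕ} (hd : 2 ≤ d) (h : d < d' ∨ d = d' ∧ a' < a) :
    (fun g : ℕ => hurwitz (g + a) d) =o[atTop] fun g : ℕ => hurwitz (g + a') d' := by
  have hd' : 2 ≤ d' := by omega
  rw [(hurwitz_isTheta hd a).isLittleO_congr_left, (hurwitz_isTheta hd' a').isLittleO_congr_right]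
  rcases h with h | ⟨rfl, h⟩
  · refine isLittleO_pow_div_factorial_of_lt_left (by positivity) ?_ _ _
    have : d.choose 2 < d'.choose 2 := by
      calc d.choose 2 < (d + 1).choose 2 := by
            have := Nat.choose_succ_succ' d 1
            rw [Nat.choose_one_right] at this
            norm_num at this
            omega
        _ ≤ d'.choose 2 := Nat.choose_le_choose 2 h
    gcongr
  · exact isLittleO_pow_div_factorial_of_lt_right _ (by omega)

lemma frequently_hurwitz_ne_zero {d : ℕ} (hd : 2 ≤ d) (a : ℕ) :
    ∃ᶠ g in atTop, hurwitz (g + a) d ≠ 0 := by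
  intro h
  have h1 := (hurwitz_isTheta hd a).eq_zero_iff
  obtain ⟨g, hg, hg'⟩ := (h.and h1).exists
  have hb : 0 < d.choose 2 := Nat.choose_pos hd
  have := hg'.1 (not_not.1 hg)
  rw [div_eq_zero_iff] at this
  rcases this with h | h <;> exact absurd h (by positivity)

/-- The simple Hurwitz numbers do not satisfy a 1-point recursion. -/
theorem hurwitz_no_one_point_recursion :
    ¬ ∃ (I J : ℕ) (p : ℕ → ℕ → Polynomial ℂ),
      (∃ i ≤ I, ∃ j ≤ J, p i j ≠ 0) ∧
      ∀ g d : ℕ, I ≤ g → J + 1 ≤ d →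
        ∑ i ∈ Finset.range (I + 1), ∑ j ∈ Finset.range (J + 1),
          (p i j).eval (d : ℂ) * hurwitz (g - i) (d - j) = 0 := by
  rintro ⟨I, J, p, ⟨i, hi, j, hj, hne⟩, hrec⟩
  refine hne (Polynomial.eq_zero_of_infinite_isRoot _ ?_)
  refine Set.Infinite.mono (s := (fun d : ℕ => (d : ℂ)) '' Set.Ici (J + 2)) ?_
    ((Set.Ici_infinite _).image Nat.cast_injective.injOn)
  rintro _ ⟨d, hd, rfl⟩
  rw [Set.mem_Ici] at hd
  refine eq_zero_of_sum_eq_zero_of_isLittleO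
    (Finset.range (I + 1) ×ˢ Finset.range (J + 1))
    (fun q g => hurwitz (g + (I - q.1)) (d - q.2))
    (fun q => toLex (OrderDual.toDual q.2, q.1)) ?_ ?_ ?_
    (fun q => (p q.1 q.2).eval (d : ℂ)) ?_ (i, j) (by simp; omega)
  · rintro ⟨a, b⟩ ⟨a', b'⟩ h
    simpa [and_comm] using h
  · rintro ⟨a, b⟩ hq ⟨a', b'⟩ hq' h
    simp only [Finset.mem_product, Finset.mem_range] at hq hq'
    rw [Prod.Lex.toLex_lt_toLex] at h
    refine hurwitz_isLittleO (by simp only; omega) ?_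
    rcases h with h | ⟨h, h'⟩
    · have : b' < b := h
      simp only; omega
    · have : b = b' := h
      simp only at h' ⊢
      omega
  · rintro ⟨a, b⟩ hq
    simp only [Finset.mem_product, Finset.mem_range] at hq
    exact frequently_hurwitz_ne_zero (by simp only; omega) _
  · intro g
    rw [Finset.sum_product, ← hrec (g + I) d (by omega) (by omega)]
    refine Finset.sum_congr rfl fun a ha => Finset.sum_congr rfl fun b _ => ?_
    rw [Finset.mem_range] at ha
    rw [Nat.add_sub_assoc (by omega)]
end

section
/- (Proposition 5.4, 1-point recursion for monotone Hurwitz numbers) For integers d ≥ 1 and m ≥ 0, let M(d, m) be the number of m-tuples (τ₁, …, τ_m) of transpositions in S_d such that, writing τ_i = (a_i b_i) with a_i < b_i, one has b₁ ≤ b₂ ≤ ⋯ ≤ b_m, and such that the product τ₁∘τ₂∘⋯∘τ_m is a d-cycle. For g ≥ 0 define the 1-part monotone Hurwitz number m_g(d) = M(d, d+2g−1)/(d−1)!. With the convention m_g(d) = 0 for g < 0, for all integers g ≥ 0 and d ≥ 2 one has d·m_g(d) = 2(2d−3)·m_g(d−1) + d(d−1)²·m_{g−1}(d). -/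
/-- `Mono d m` is the number of monotone `m`-tuples of transpositions in the symmetric
group on `d` letters whose product is a `d`-cycle: a tuple is encoded by the pairs
`(aᵢ, bᵢ)` with `aᵢ < bᵢ` and the higher elements `bᵢ` weakly increasing, and the
product `τ₁ ∘ ⋯ ∘ τ_m` is required to have the same cycle type as the standard
`d`-cycle. -/
noncomputable def Mono (d m : ℕ) : ℕ :=
  Nat.card {f : Fin m → Fin d × Fin d //
    (∀ i, (f i).1 < (f i).2) ∧
    (∀ i j : Fin m, i ≤ j → (f i).2 ≤ (f j).2) ∧
    (List.ofFn fun i => Equiv.swap (f i).1 (f i).2).prod.cycleType =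
      (finRotate d).cycleType}

/-- The 1-part monotone Hurwitz number `m_g(d) = M(d, d+2g−1)/(d−1)!`, with the
convention that it is `0` for `g < 0`. -/
noncomputable def monotoneHurwitz (g : ℤ) (d : ℕ) : ℚ :=
  if g < 0 then 0 else (Mono d (d + 2 * g.toNat - 1) : ℚ) / ((d - 1).factorial : ℚ)

namespace MonotoneHurwitz

section HookSeries

open PowerSeries

/-- The geometric power series `∑ xⁿ Xⁿ = 1 / (1 - x X)`. -/
noncomputable def geom (x : ℤ) : ℤ⟦X⟧ := PowerSeries.mk fun n => x ^ n

lemma one_sub_mul_geom (x : ℤ) : (1 - (x : ℤ⟦X⟧) * X) * geom x = 1 := by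
  ext n
  rw [sub_mul, one_mul, mul_assoc, ← map_intCast (PowerSeries.C (R := ℤ)) x, map_sub,
    PowerSeries.coeff_C_mul]
  cases n with
  | zero => simp [geom]
  | succ n => simp [geom, PowerSeries.coeff_succ_X_mul, PowerSeries.coeff_one, pow_succ']

/-- The generating series of the complete homogeneous symmetric polynomials in the contents
`-r, …, n - 1 - r` of a hook with `n` boxes and leg length `r`. -/
noncomputable def hookSeries (n r : ℕ) : ℤ⟦X⟧ := ∏ k ∈ Finset.range n, geom ((k : ℤ) - r)

lemma hookSeries_succ (n r : ℕ) :
    (1 - ((n : ℤ⟦X⟧) - (r : ℤ⟦X⟧)) * X) * hookSeries (n + 1) r = hookSeries n r := by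
  have h := one_sub_mul_geom ((n : ℤ) - r)
  push_cast at h
  rw [hookSeries, Finset.prod_range_succ, mul_left_comm, h, mul_one, hookSeries]

lemma hookSeries_succ' (n r : ℕ) :
    (1 + ((r : ℤ⟦X⟧) + 1) * X) * hookSeries (n + 1) (r + 1) = hookSeries n r := by
  have h := one_sub_mul_geom (-((r : ℤ) + 1))
  push_cast at h
  have e : (1 - -((r : ℤ⟦X⟧) + 1) * X) = 1 + ((r : ℤ⟦X⟧) + 1) * X := by ring
  rw [e] at h
  have h0 : ((0 : ℕ) : ℤ) - ((r + 1 : ℕ) : ℤ) = -((r : ℤ) + 1) := by push_cast; ring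
  rw [hookSeries, Finset.prod_range_succ', h0, mul_left_comm, h, mul_one, hookSeries]
  refine Finset.prod_congr rfl fun k _ => ?_
  congr 1
  push_cast
  ring

/-- The alternating sum over all hooks with `n + 1` boxes of their content series, weighted by
dimension. -/
noncomputable def hookSum (n : ℕ) : ℤ⟦X⟧ :=
  ∑ r ∈ Finset.range (n + 1), (-1) ^ r * (n.choose r : ℤ⟦X⟧) * hookSeries (n + 1) r

lemma sum_alternating_choose_succ {R : Type*} [CommRing R] (n : ℕ) (f : ℕ → R) :
    ∑ r ∈ Finset.range (n + 2), (-1) ^ r * ((n + 1).choose r : R) * f r =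
      ∑ r ∈ Finset.range (n + 1), (-1) ^ r * (n.choose r : R) * (f r - f (r + 1)) := by
  have h : ∑ r ∈ Finset.range (n + 1), (-1) ^ r * (n.choose r : R) * f r =
      ∑ r ∈ Finset.range (n + 1), (-1) ^ (r + 1) * (n.choose (r + 1) : R) * f (r + 1) + f 0 := by
    have := Finset.sum_range_succ' (fun r => (-1) ^ r * (n.choose r : R) * f r) (n + 1)
    rw [Finset.sum_range_succ] at this
    simpa using this
  rw [Finset.sum_range_succ']
  simp_rw [mul_sub]
  rw [Finset.sum_sub_distrib, h]
  simp only [pow_zero, Nat.choose_zero_right, Nat.cast_one, one_mul]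
  rw [add_sub_right_comm, ← Finset.sum_sub_distrib]
  congr 1
  refine Finset.sum_congr rfl fun r _ => ?_
  rw [Nat.choose_succ_succ]
  push_cast
  ring

lemma hookSum_succ (n : ℕ) :
    hookSum (n + 1) = 2 * (2 * (n : ℤ⟦X⟧) + 1) * X * hookSum n +
      ((n : ℤ⟦X⟧) + 1) ^ 2 * X ^ 2 * hookSum (n + 1) := by
  set V : ℕ → ℤ⟦X⟧ := fun r => (-1) ^ r * (n.choose r : ℤ⟦X⟧) * X * (r : ℤ⟦X⟧) *
    (X * ((n : ℤ⟦X⟧) + 1 - 2 * (r : ℤ⟦X⟧)) - 3) * hookSeries (n + 2) r with hV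
  have key : ∀ r ∈ Finset.range (n + 1), (1 - ((n : ℤ⟦X⟧) + 1) ^ 2 * X ^ 2) * ((-1) ^ r *
      (n.choose r : ℤ⟦X⟧) * (hookSeries (n + 2) r - hookSeries (n + 2) (r + 1))) -
      2 * (2 * (n : ℤ⟦X⟧) + 1) * X * ((-1) ^ r * (n.choose r : ℤ⟦X⟧) * hookSeries (n + 1) r) =
      V r - V (r + 1) := by
    intro r hr
    have h1 := hookSeries_succ (n + 1) r
    have h2 := hookSeries_succ' (n + 1) r
    have h3 : (n.choose (r + 1) : ℤ⟦X⟧) * ((r : ℤ⟦X⟧) + 1) =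
        (n.choose r : ℤ⟦X⟧) * ((n : ℤ⟦X⟧) - (r : ℤ⟦X⟧)) := by
      have hle : r ≤ n := Nat.lt_succ_iff.mp (Finset.mem_range.mp hr)
      have := congrArg (Nat.cast : ℕ → ℤ⟦X⟧) (Nat.choose_succ_right_eq n r)
      simpa only [Nat.cast_mul, Nat.cast_sub hle, Nat.cast_succ] using this
    have e : V (r + 1) = -((-1) ^ r * ((n.choose r : ℤ⟦X⟧) * ((n : ℤ⟦X⟧) - (r : ℤ⟦X⟧))) * X *
        (X * ((n : ℤ⟦X⟧) + 1 - 2 * ((r : ℤ⟦X⟧) + 1)) - 3) * hookSeries (n + 2) (r + 1)) := by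
      rw [← h3, hV]; push_cast; ring
    rw [e, hV]
    push_cast at h1 h2 ⊢
    generalize hookSeries (n + 2) r = W at *
    generalize hookSeries (n + 2) (r + 1) = W' at *
    generalize hookSeries (n + 1) r = U at *
    generalize (n : ℤ⟦X⟧) = N at *
    linear_combination (-1) ^ r * (n.choose r : ℤ⟦X⟧) *
      ((1 + (N + 1 - (r : ℤ⟦X⟧)) * X + 3 * (r : ℤ⟦X⟧) * X) * h1 +
      (-1 + ((r : ℤ⟦X⟧) + 1) * X + 3 * (N - (r : ℤ⟦X⟧)) * X) * h2)
  have h := Finset.sum_congr rfl key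
  rw [Finset.sum_sub_distrib, ← Finset.mul_sum, ← Finset.mul_sum, Finset.sum_range_sub',
    ← sum_alternating_choose_succ] at h
  have hV0 : V 0 = 0 := by simp [hV]
  have hVn : V (n + 1) = 0 := by simp [hV]
  rw [hV0, hVn] at h
  simp only [hookSum]
  linear_combination h

lemma coeff_hookSum_succ (n m : ℕ) :
    coeff (m + 2) (hookSum (n + 1)) = 2 * (2 * n + 1) * coeff (m + 1) (hookSum n) +
      (n + 1) ^ 2 * coeff m (hookSum (n + 1)) := by
  have h := congrArg (coeff (m + 2)) (hookSum_succ n)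
  have e : 2 * (2 * (n : ℤ⟦X⟧) + 1) * X * hookSum n +
      ((n : ℤ⟦X⟧) + 1) ^ 2 * X ^ 2 * hookSum (n + 1) =
    X * (C (2 * (2 * (n : ℤ) + 1)) * hookSum n) +
      X ^ 2 * (C (((n : ℤ) + 1) ^ 2) * hookSum (n + 1)) := by
    simp only [map_mul, map_add, map_pow, map_natCast, map_one, map_ofNat]
    ring
  rw [e, map_add, coeff_succ_X_mul, coeff_C_mul, coeff_X_pow_mul, coeff_C_mul] at h
  exact h

lemma constantCoeff_hookSum_succ (n : ℕ) : constantCoeff (hookSum (n + 1)) = 0 := by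
  rw [hookSum_succ]
  simp [mul_assoc]

lemma coeff_one_hookSum_succ (n : ℕ) :
    coeff 1 (hookSum (n + 1)) = 2 * (2 * n + 1) * coeff 0 (hookSum n) := by
  have e : hookSum (n + 1) = X * (2 * (2 * (n : ℤ⟦X⟧) + 1) * hookSum n +
      X * (((n : ℤ⟦X⟧) + 1) ^ 2 * hookSum (n + 1))) := by
    linear_combination hookSum_succ n
  have hC : 2 * (2 * (n : ℤ⟦X⟧) + 1) = C (2 * (2 * (n : ℤ) + 1)) := by simp
  rw [e, hC]
  refine (coeff_succ_X_mul 0 _).trans ?_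
  rw [map_add, coeff_C_mul, coeff_zero_X_mul, add_zero]

lemma coeff_hookSum_of_lt {n m : ℕ} (h : m < n) : coeff m (hookSum n) = 0 := by
  induction n generalizing m with
  | zero => omega
  | succ n ih =>
    induction m using Nat.strong_induction_on with
    | _ m ihm =>
      match m with
      | 0 => simpa using constantCoeff_hookSum_succ n
      | 1 => rw [coeff_one_hookSum_succ, ih (by omega), mul_zero]
      | m + 2 =>
        rw [coeff_hookSum_succ, ih (by omega), ihm m (by omega) (by omega)]
        simp

lemma coeff_hookSum_succ_self (n : ℕ) :
    coeff (n + 1) (hookSum (n + 1)) = 2 * (2 * n + 1) * coeff n (hookSum n) := by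
  cases n with
  | zero => exact coeff_one_hookSum_succ 0
  | succ n => rw [coeff_hookSum_succ, coeff_hookSum_of_lt (by omega : n < n + 1 + 1), mul_zero,
      add_zero]

end HookSeries

open Equiv

/-- The `k`-th Jucys–Murphy element of the integral group algebra of the symmetric group. -/
noncomputable def jucysMurphy {d : ℕ} (k : Fin d) : MonoidAlgebra ℤ (Perm (Fin d)) :=
  ∑ a ∈ Finset.Iio k, MonoidAlgebra.of ℤ _ (swap a k)

/-- Monotone `m`-tuples of transpositions whose higher elements are all less than `k`. -/
def IsMonotoneBelow {d m : ℕ} (k : ℕ) (f : Fin m → Fin d × Fin d) : Prop :=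
  (∀ i, (f i).1 < (f i).2) ∧ (∀ i j : Fin m, i ≤ j → (f i).2 ≤ (f j).2) ∧
    ∀ i, ((f i).2 : ℕ) < k

/-- The product of the transpositions encoded by a tuple of pairs. -/
def swapProd {d m : ℕ} (f : Fin m → Fin d × Fin d) : Perm (Fin d) :=
  (List.ofFn fun i => swap (f i).1 (f i).2).prod

open Classical in
/-- The sum, in the group algebra, of the products of all monotone `m`-tuples of transpositions
whose higher elements are less than `k`. -/
noncomputable def monoSum (d k m : ℕ) : MonoidAlgebra ℤ (Perm (Fin d)) :=
  ∑ f : Fin m → Fin d × Fin d with IsMonotoneBelow k f, MonoidAlgebra.of ℤ _ (swapProd f)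

lemma monoSum_zero_right (d k : ℕ) : monoSum d k 0 = 1 := by
  have h : ∀ f : Fin 0 → Fin d × Fin d, IsMonotoneBelow k f := fun f =>
    ⟨fun i => i.elim0, fun i => i.elim0, fun i => i.elim0⟩
  simp only [monoSum, h, Finset.filter_true, Finset.univ_unique, Finset.sum_singleton]
  simp [swapProd, MonoidAlgebra.one_def]

lemma monoSum_zero_succ (d m : ℕ) : monoSum d 0 (m + 1) = 0 := by
  classical
  rw [monoSum, Finset.sum_eq_zero]
  intro f hf
  exact absurd ((Finset.mem_filter.mp hf).2.2.2 0) (by simp)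

lemma swapProd_snoc {d m : ℕ} (f : Fin m → Fin d × Fin d) (p : Fin d × Fin d) :
    swapProd (Fin.snoc f p : Fin (m + 1) → Fin d × Fin d) = swapProd f * swap p.1 p.2 := by
  rw [swapProd, List.ofFn_succ', List.concat_eq_append]
  simp [swapProd]

lemma isMonotoneBelow_snoc {d m : ℕ} (k a : Fin d) (f : Fin m → Fin d × Fin d) :
    IsMonotoneBelow (k + 1) (Fin.snoc f (a, k) : Fin (m + 1) → Fin d × Fin d) ↔
      IsMonotoneBelow (k + 1) f ∧ a < k := by
  constructor
  · rintro ⟨h1, h2, h3⟩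
    refine ⟨⟨fun i => ?_, fun i j hij => ?_, fun i => ?_⟩, ?_⟩
    · simpa using h1 i.castSucc
    · simpa using h2 i.castSucc j.castSucc (by simpa using hij)
    · simpa using h3 i.castSucc
    · simpa using h1 (Fin.last m)
  · rintro ⟨⟨h1, h2, h3⟩, h⟩
    refine ⟨fun i => ?_, fun i j => ?_, fun i => ?_⟩
    · induction i using Fin.lastCases with
      | last => simpa using h
      | cast i => simpa using h1 i
    · induction j using Fin.lastCases with
      | last =>
        induction i using Fin.lastCases with
        | last => simp
        | cast i =>
          intro _
          rw [Fin.snoc_castSucc, Fin.snoc_last]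
          exact Fin.le_iff_val_le_val.mpr (Nat.lt_succ_iff.mp (h3 i))
      | cast j =>
        induction i using Fin.lastCases with
        | last => intro hij; exact absurd hij (by simp)
        | cast i => simpa using h2 i j
    · induction i using Fin.lastCases with
      | last => simp
      | cast i => simpa using h3 i

lemma monoSum_succ_succ {d : ℕ} (k : Fin d) (m : ℕ) :
    monoSum d (k + 1) (m + 1) =
      monoSum d k (m + 1) + monoSum d (k + 1) m * jucysMurphy k := by
  classical
  rw [monoSum, ← Finset.sum_filter_add_sum_filter_not _
    (fun f : Fin (m + 1) → Fin d × Fin d => ((f (Fin.last m)).2 : ℕ) < k)]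
  congr 1
  · rw [monoSum, Finset.filter_filter]
    refine Finset.sum_congr (Finset.filter_congr fun f _ => ?_) fun _ _ => rfl
    constructor
    · rintro ⟨⟨h1, h2, h3⟩, h⟩
      exact ⟨h1, h2, fun i => lt_of_le_of_lt (h2 i _ (Fin.le_last i)) h⟩
    · rintro ⟨h1, h2, h3⟩
      exact ⟨⟨h1, h2, fun i => (h3 i).trans (Nat.lt_succ_self _)⟩, h3 _⟩
  · rw [monoSum, jucysMurphy, Finset.sum_mul_sum, ← Finset.sum_product']
    symm
    refine Finset.sum_bij' (fun p _ => Fin.snoc p.1 (p.2, k))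
      (fun f _ => (Fin.init f, (f (Fin.last m)).1)) ?_ ?_ ?_ ?_ ?_
    · rintro ⟨f, a⟩ h
      simp only [Finset.mem_product, Finset.mem_filter, Finset.mem_univ, true_and,
        Finset.mem_Iio] at h
      simpa [isMonotoneBelow_snoc] using h
    · intro f h
      simp only [Finset.mem_filter, Finset.mem_univ, true_and] at h
      have hk : (f (Fin.last m)).2 = k :=
        Fin.ext (le_antisymm (Nat.lt_succ_iff.mp (h.1.2.2 _)) (not_lt.mp h.2))
      have hf : f = Fin.snoc (Fin.init f) ((f (Fin.last m)).1, k) := by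
        conv_lhs => rw [← Fin.snoc_init_self f]
        rw [← hk]
      rw [hf, isMonotoneBelow_snoc] at h
      simpa using h.1
    · rintro ⟨f, a⟩ h
      simp
    · intro f h
      simp only [Finset.mem_filter, Finset.mem_univ, true_and] at h
      have hk : (f (Fin.last m)).2 = k :=
        Fin.ext (le_antisymm (Nat.lt_succ_iff.mp (h.1.2.2 _)) (not_lt.mp h.2))
      conv_rhs => rw [← Fin.snoc_init_self f]
      rw [← hk]
    · rintro ⟨f, a⟩ h
      rw [swapProd_snoc, map_mul]

lemma of_mul_jucysMurphy {d : ℕ} (g : Perm (Fin d)) (k : Fin d) :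
    MonoidAlgebra.of ℤ _ g * jucysMurphy k =
      (∑ a ∈ (Finset.Iio k).map g.toEmbedding, MonoidAlgebra.of ℤ _ (swap a (g k))) *
        MonoidAlgebra.of ℤ _ g := by
  rw [jucysMurphy, Finset.mul_sum, Finset.sum_map, Finset.sum_mul]
  refine Finset.sum_congr rfl fun a _ => ?_
  rw [← map_mul, ← map_mul]
  congr 1
  ext x
  simp [swap_apply_apply]

lemma commute_of_jucysMurphy {d : ℕ} {g : Perm (Fin d)} {k : Fin d} (hk : g k = k)
    (hg : ∀ a, g a < k ↔ a < k) : Commute (MonoidAlgebra.of ℤ _ g) (jucysMurphy k) := by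
  have h : (Finset.Iio k).map g.toEmbedding = Finset.Iio k := by
    ext a
    simp only [Finset.mem_map_equiv, Finset.mem_Iio]
    rw [← hg, apply_symm_apply]
  rw [Commute, SemiconjBy, of_mul_jucysMurphy, h, hk, jucysMurphy]

lemma commute_of_swap_jucysMurphy {d : ℕ} {a b k : Fin d} (ha : a ≠ k) (hb : b ≠ k)
    (h : a < k ↔ b < k) : Commute (MonoidAlgebra.of ℤ _ (swap a b)) (jucysMurphy k) := by
  refine commute_of_jucysMurphy (swap_apply_of_ne_of_ne ha.symm hb.symm) fun x => ?_
  rw [swap_apply_def]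
  split_ifs with h1 h2
  · rw [h1, h]
  · rw [h2, h]
  · rfl

lemma commute_jucysMurphy {d : ℕ} {j k : Fin d} (h : j < k) :
    Commute (jucysMurphy j) (jucysMurphy k) :=
  Commute.sum_left _ _ _ fun _ ha =>
    have ha := (Finset.mem_Iio.mp ha).trans h
    commute_of_swap_jucysMurphy ha.ne h.ne (iff_of_true ha h)

lemma of_swap_mul_jucysMurphy_succ {n : ℕ} (i : Fin n) :
    MonoidAlgebra.of ℤ _ (swap i.castSucc i.succ) * jucysMurphy i.succ =
      jucysMurphy i.castSucc * MonoidAlgebra.of ℤ _ (swap i.castSucc i.succ) + 1 := by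
  have hI : Finset.Iio i.succ = insert i.castSucc (Finset.Iio i.castSucc) := by
    ext a
    simp only [Finset.mem_Iio, Finset.mem_insert, Fin.lt_def, Fin.ext_iff, Fin.val_succ,
      Fin.val_castSucc]
    omega
  rw [jucysMurphy, hI, Finset.sum_insert (by simp), mul_add, ← map_mul, swap_mul_self, map_one,
    add_comm (1 : MonoidAlgebra ℤ (Perm (Fin (n + 1)))), jucysMurphy, Finset.mul_sum,
    Finset.sum_mul]
  congr 1
  refine Finset.sum_congr rfl fun a ha => ?_
  have ha' := Finset.mem_Iio.mp ha
  have h1 : a ≠ i.castSucc := ha'.ne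
  have h2 : a ≠ i.succ := (ha'.trans (Fin.castSucc_lt_succ)).ne
  rw [← map_mul, ← map_mul]
  congr 1
  rw [mul_swap_eq_swap_mul, swap_apply_right, swap_apply_of_ne_of_ne h1 h2]

lemma jucysMurphy_succ_mul_of_swap {n : ℕ} (i : Fin n) :
    jucysMurphy i.succ * MonoidAlgebra.of ℤ _ (swap i.castSucc i.succ) =
      MonoidAlgebra.of ℤ _ (swap i.castSucc i.succ) * jucysMurphy i.castSucc + 1 := by
  have h := of_swap_mul_jucysMurphy_succ i
  have hs : MonoidAlgebra.of ℤ _ (swap i.castSucc i.succ) *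
      MonoidAlgebra.of ℤ _ (swap i.castSucc i.succ) = 1 := by
    rw [← map_mul, swap_mul_self, map_one]
  generalize MonoidAlgebra.of ℤ _ (swap i.castSucc i.succ) = s at *
  have h' : jucysMurphy i.succ = s * jucysMurphy i.castSucc * s + s := by
    rw [← one_mul (jucysMurphy i.succ), ← hs, mul_assoc, h, mul_add, mul_one, mul_assoc]
  rw [h', add_mul, mul_assoc, hs, mul_one]

lemma commute_monoSum_of_commute {d : ℕ} {x : MonoidAlgebra ℤ (Perm (Fin d))} (j k m : ℕ)
    (hk : k ≤ d) (hj : ∀ m, Commute x (monoSum d j m))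
    (hjk : j ≤ k) (h : ∀ i : Fin d, j ≤ i → (i : ℕ) < k → Commute x (jucysMurphy i)) :
    Commute x (monoSum d k m) := by
  induction k, hjk using Nat.le_induction generalizing m with
  | base => exact hj m
  | succ k hjk ih =>
    induction m with
    | zero => rw [monoSum_zero_right]; exact Commute.one_right x
    | succ m ihm =>
      have := monoSum_succ_succ (⟨k, hk⟩ : Fin d) m
      simp only at this
      rw [this]
      exact (ih (m + 1) (by omega) fun i h1 h2 => h i h1 (by omega)).add_right
        (ihm.mul_right (h _ hjk (Nat.lt_succ_self k)))

lemma commute_swap_monoSum {n : ℕ} (i : Fin n) (m : ℕ) :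
    Commute (MonoidAlgebra.of ℤ _ (swap i.castSucc i.succ)) (monoSum (n + 1) (i + 2) m) := by
  have hlow : ∀ m, Commute (MonoidAlgebra.of ℤ _ (swap i.castSucc i.succ))
      (monoSum (n + 1) i m) := by
    intro m
    refine commute_monoSum_of_commute 0 i m (by omega) (fun m => ?_) (by omega) fun k _ hk => ?_
    · cases m with
      | zero => rw [monoSum_zero_right]; exact Commute.one_right _
      | succ m => rw [monoSum_zero_succ]; exact Commute.zero_right _
    · refine commute_of_swap_jucysMurphy ?_ ?_ ?_ <;>
        simp only [ne_eq, Fin.ext_iff, Fin.lt_def, Fin.val_castSucc, Fin.val_succ] <;> omega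
  have h1 : ∀ m, monoSum (n + 1) (i + 1) (m + 1) = monoSum (n + 1) i (m + 1) +
      monoSum (n + 1) (i + 1) m * jucysMurphy i.castSucc := fun m => monoSum_succ_succ i.castSucc m
  have h2 : ∀ m, monoSum (n + 1) (i + 2) (m + 1) = monoSum (n + 1) (i + 1) (m + 1) +
      monoSum (n + 1) (i + 2) m * jucysMurphy i.succ := fun m => monoSum_succ_succ i.succ m
  have hJ := commute_jucysMurphy (Fin.castSucc_lt_succ (i := i))
  have e1 := of_swap_mul_jucysMurphy_succ i
  have e2 := jucysMurphy_succ_mul_of_swap i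
  generalize MonoidAlgebra.of ℤ _ (swap i.castSucc i.succ) = s at *
  generalize jucysMurphy i.castSucc = x at *
  generalize jucysMurphy i.succ = y at *
  have hadd : Commute s (x + y) := by
    rw [Commute, SemiconjBy, mul_add, add_mul, e1, e2]
    abel
  have hmul : Commute s (y * x) := by
    rw [Commute, SemiconjBy, ← mul_assoc, e1, ← hJ.eq, mul_assoc x, e2]
    noncomm_ring
  induction m using Nat.strong_induction_on with
  | _ m ih =>
    match m with
    | 0 => rw [monoSum_zero_right]; exact Commute.one_right s
    | 1 =>
      rw [h2, h1, monoSum_zero_right, monoSum_zero_right, one_mul, one_mul, add_assoc]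
      exact (hlow 1).add_right hadd
    | m + 2 =>
      have e : monoSum (n + 1) (i + 2) (m + 2) = monoSum (n + 1) i (m + 2) +
          monoSum (n + 1) (i + 2) (m + 1) * (x + y) - monoSum (n + 1) (i + 2) m * (y * x) := by
        rw [h2, h1, ← sub_eq_zero]
        have := h2 m
        rw [← sub_eq_iff_eq_add] at this
        rw [← this]
        noncomm_ring
      rw [e]
      exact ((hlow _).add_right ((ih _ (by omega)).mul_right hadd)).sub_right
        ((ih _ (by omega)).mul_right hmul)

/-- The sum of all monotone products of a given length is central in the group algebra. -/
lemma commute_of_monoSum {n : ℕ} (g : Perm (Fin (n + 1))) (m : ℕ) :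
    Commute (MonoidAlgebra.of ℤ _ g) (monoSum (n + 1) (n + 1) m) := by
  have hg : g ∈ Submonoid.closure (Set.range fun i : Fin n ↦ swap i.castSucc i.succ) := by
    rw [Perm.mclosure_swap_castSucc_succ]; trivial
  induction hg using Submonoid.closure_induction with
  | mem g hg =>
    obtain ⟨i, rfl⟩ := hg
    refine commute_monoSum_of_commute (i + 2) (n + 1) m le_rfl
      (commute_swap_monoSum i) (by omega) fun k hk _ => commute_of_swap_jucysMurphy ?_ ?_ ?_ <;>
      simp only [ne_eq, Fin.ext_iff, Fin.lt_def, Fin.val_castSucc, Fin.val_succ] <;> omega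
  | one => rw [map_one]; exact Commute.one_left _
  | mul g g' _ _ h h' => rw [map_mul]; exact h.mul_left h'

section HookElements

/-- The antisymmetrizer over the permutations of `{0} ∪ {i + 1 | i ∈ S}`. -/
noncomputable def antisymmetrizer {n : ℕ} (S : Finset (Fin n)) :
    MonoidAlgebra ℤ (Perm (Fin (n + 1))) :=
  ∑ α : Perm (Fin (n + 1)) with ∀ i ∉ S, α i.succ = i.succ,
    (Perm.sign α : ℤ) • MonoidAlgebra.of ℤ _ α

/-- The symmetrizer over the permutations that fix `{i + 1 | i ∈ S}` pointwise. -/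
noncomputable def symmetrizer {n : ℕ} (S : Finset (Fin n)) :
    MonoidAlgebra ℤ (Perm (Fin (n + 1))) :=
  ∑ β : Perm (Fin (n + 1)) with ∀ i ∈ S, β i.succ = i.succ, MonoidAlgebra.of ℤ _ β

variable {n : ℕ} {S : Finset (Fin n)}

lemma of_mul_antisymmetrizer {τ : Perm (Fin (n + 1))} (hτ : ∀ i ∉ S, τ i.succ = i.succ) :
    MonoidAlgebra.of ℤ _ τ * antisymmetrizer S = (Perm.sign τ : ℤ) • antisymmetrizer S := by
  rw [antisymmetrizer, Finset.mul_sum, Finset.smul_sum]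
  have hτ' : ∀ i ∉ S, τ⁻¹ i.succ = i.succ := fun i hi => Perm.inv_eq_iff_eq.mpr (hτ i hi).symm
  refine Finset.sum_bij' (fun α _ => τ * α) (fun α _ => τ⁻¹ * α) ?_ ?_ ?_ ?_ ?_
  · intro α h
    simp only [Finset.mem_filter, Finset.mem_univ, true_and, Perm.mul_apply] at h ⊢
    intro i hi
    rw [h i hi, hτ i hi]
  · intro α h
    simp only [Finset.mem_filter, Finset.mem_univ, true_and, Perm.mul_apply] at h ⊢
    intro i hi
    rw [h i hi, hτ' i hi]
  · intro α _; simp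
  · intro α _; simp
  · intro α _
    rw [mul_smul_comm, ← map_mul, smul_smul, Perm.sign_mul]
    congr 1
    rw [Units.val_mul, ← mul_assoc, ← Units.val_mul, Int.units_mul_self, Units.val_one, one_mul]

lemma antisymmetrizer_mul_of {τ : Perm (Fin (n + 1))} (hτ : ∀ i ∉ S, τ i.succ = i.succ) :
    antisymmetrizer S * MonoidAlgebra.of ℤ _ τ = (Perm.sign τ : ℤ) • antisymmetrizer S := by
  rw [antisymmetrizer, Finset.sum_mul, Finset.smul_sum]
  have hτ' : ∀ i ∉ S, τ⁻¹ i.succ = i.succ := fun i hi => Perm.inv_eq_iff_eq.mpr (hτ i hi).symm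
  refine Finset.sum_bij' (fun α _ => α * τ) (fun α _ => α * τ⁻¹) ?_ ?_ ?_ ?_ ?_
  · intro α h
    simp only [Finset.mem_filter, Finset.mem_univ, true_and, Perm.mul_apply] at h ⊢
    intro i hi
    rw [hτ i hi, h i hi]
  · intro α h
    simp only [Finset.mem_filter, Finset.mem_univ, true_and, Perm.mul_apply] at h ⊢
    intro i hi
    rw [hτ' i hi, h i hi]
  · intro α _; simp
  · intro α _; simp
  · intro α _
    rw [smul_mul_assoc, ← map_mul, smul_smul, Perm.sign_mul]
    congr 1
    rw [Units.val_mul, mul_comm (Perm.sign α : ℤ), ← mul_assoc, ← Units.val_mul,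
      Int.units_mul_self, Units.val_one, one_mul]

lemma of_mul_symmetrizer {τ : Perm (Fin (n + 1))} (hτ : ∀ i ∈ S, τ i.succ = i.succ) :
    MonoidAlgebra.of ℤ _ τ * symmetrizer S = symmetrizer S := by
  rw [symmetrizer, Finset.mul_sum]
  have hτ' : ∀ i ∈ S, τ⁻¹ i.succ = i.succ := fun i hi => Perm.inv_eq_iff_eq.mpr (hτ i hi).symm
  refine Finset.sum_bij' (fun α _ => τ * α) (fun α _ => τ⁻¹ * α) ?_ ?_ ?_ ?_ ?_
  · intro α h
    simp only [Finset.mem_filter, Finset.mem_univ, true_and, Perm.mul_apply] at h ⊢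
    intro i hi
    rw [h i hi, hτ i hi]
  · intro α h
    simp only [Finset.mem_filter, Finset.mem_univ, true_and, Perm.mul_apply] at h ⊢
    intro i hi
    rw [h i hi, hτ' i hi]
  · intro α _; simp
  · intro α _; simp
  · intro α _
    rw [← map_mul]

lemma commute_antisymmetrizer {x : MonoidAlgebra ℤ (Perm (Fin (n + 1)))}
    (h : ∀ α : Perm (Fin (n + 1)), (∀ i ∉ S, α i.succ = i.succ) →
      Commute x (MonoidAlgebra.of ℤ _ α)) : Commute x (antisymmetrizer S) :=
  Commute.sum_right _ _ _ fun α hα => (h α (Finset.mem_filter.mp hα).2).smul_right _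

lemma swap_succ_fixed {a b : Fin (n + 1)} {i : Fin n} (ha : i.succ ≠ a) (hb : i.succ ≠ b) :
    swap a b i.succ = i.succ := swap_apply_of_ne_of_ne ha hb

/-- A Garnir-type relation for hook shapes. -/
lemma antisymmetrizer_mul_swap_mul_symmetrizer {i j : Fin n} (hi : i ∈ S) (hj : j ∉ S) :
    antisymmetrizer S * MonoidAlgebra.of ℤ _ (swap i.succ j.succ) * symmetrizer S = 0 := by
  have hij : i ≠ j := fun h => hj (h ▸ hi)
  have hB : MonoidAlgebra.of ℤ _ (swap 0 j.succ) * symmetrizer S = symmetrizer S :=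
    of_mul_symmetrizer fun k hk => swap_succ_fixed (Fin.succ_ne_zero k)
      (fun h => hj (Fin.succ_injective _ h ▸ hk))
  have hA : antisymmetrizer S * MonoidAlgebra.of ℤ _ (swap 0 i.succ) = -antisymmetrizer S := by
    rw [antisymmetrizer_mul_of fun k hk => swap_succ_fixed (Fin.succ_ne_zero k)
      (fun h => hk (Fin.succ_injective _ h ▸ hi)), Perm.sign_swap (Fin.succ_ne_zero i).symm]
    simp
  have hs : swap i.succ j.succ * swap 0 j.succ = swap 0 i.succ * swap i.succ j.succ := by
    rw [mul_swap_eq_swap_mul, swap_apply_right, swap_apply_of_ne_of_ne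
      (Fin.succ_ne_zero i).symm (Fin.succ_ne_zero j).symm]
  have h : antisymmetrizer S * MonoidAlgebra.of ℤ _ (swap i.succ j.succ) * symmetrizer S =
      -(antisymmetrizer S * MonoidAlgebra.of ℤ _ (swap i.succ j.succ) * symmetrizer S) := by
    conv_lhs => rw [← hB, mul_assoc, ← mul_assoc (MonoidAlgebra.of ℤ _ _), ← map_mul, hs,
      map_mul, mul_assoc, ← mul_assoc, hA, ← mul_assoc]
    rw [neg_mul, neg_mul]
  ext π
  have := congrArg (fun x => x.coeff π) h
  simp only [MonoidAlgebra.coeff_neg, Finsupp.neg_apply] at this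
  simp only [MonoidAlgebra.coeff_zero, Finsupp.zero_apply]
  omega

/-- The set `{0, …, r - 1}`. -/
def firstElements (n r : ℕ) : Finset (Fin n) := {i | (i : ℕ) < r}

lemma mem_firstElements {r : ℕ} {i : Fin n} : i ∈ firstElements n r ↔ (i : ℕ) < r := by
  simp [firstElements]

lemma fixed_of_notMem {α : Perm (Fin (n + 1))} {r : ℕ}
    (h : ∀ i ∉ firstElements n r, α i.succ = i.succ) {a : Fin (n + 1)} (ha : r < a) : α a = a := by
  cases a using Fin.cases with
  | zero => simp at ha
  | succ i => exact h i (by simpa [mem_firstElements] using ha)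

lemma jucysMurphy_mul_hook_of_le {r : ℕ} {k : Fin (n + 1)} (hk : (k : ℕ) ≤ r) :
    jucysMurphy k * antisymmetrizer (firstElements n r) =
      (-(k : ℤ)) • antisymmetrizer (firstElements n r) := by
  rw [jucysMurphy, Finset.sum_mul, Finset.sum_congr rfl (g := fun _ =>
    (-1 : ℤ) • antisymmetrizer (firstElements n r))]
  · rw [Finset.sum_const, Fin.card_Iio, ← natCast_zsmul, smul_smul]
    simp
  · intro a ha
    have ha := Finset.mem_Iio.mp ha
    rw [of_mul_antisymmetrizer, Perm.sign_swap ha.ne]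
    · simp
    · intro i hi
      rw [mem_firstElements] at hi
      rw [Fin.lt_def] at ha
      refine swap_succ_fixed ?_ ?_ <;> simp only [ne_eq, Fin.ext_iff, Fin.val_succ] <;> omega

lemma jucysMurphy_mul_hook_of_lt {r : ℕ} {k : Fin (n + 1)} (hk : r < (k : ℕ)) :
    jucysMurphy k * (antisymmetrizer (firstElements n r) * symmetrizer (firstElements n r)) =
      ((k : ℤ) - r) • (antisymmetrizer (firstElements n r) *
        symmetrizer (firstElements n r)) := by
  set A := antisymmetrizer (firstElements n r) with hA
  set B := symmetrizer (firstElements n r) with hB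
  rw [jucysMurphy, ← Finset.sum_filter_add_sum_filter_not (Finset.Iio k) (fun a => (a : ℕ) ≤ r)
    (fun a => MonoidAlgebra.of ℤ (Perm (Fin (n + 1))) (swap a k)), add_mul]
  set T := ∑ a ∈ (Finset.Iio k).filter (fun a : Fin (n + 1) => (a : ℕ) ≤ r),
    MonoidAlgebra.of ℤ _ (swap a k) with hT
  have hTA : T * A = A * T := by
    refine commute_antisymmetrizer fun α hα => ?_
    rw [Commute, SemiconjBy, hT, Finset.mul_sum, Finset.sum_mul]
    symm
    refine Finset.sum_equiv α (fun a => ?_) fun a _ => ?_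
    · have h1 : ((a : ℕ) ≤ r) ↔ ((α a : ℕ) ≤ r) := by
        rw [← not_iff_not, not_le, not_le]
        constructor
        · intro h; rwa [fixed_of_notMem hα h]
        · intro h
          rwa [← α.injective (fixed_of_notMem hα h)]
      simp only [Finset.mem_filter, Finset.mem_Iio, Fin.lt_def, ← h1]
      constructor
      · rintro ⟨_, h⟩; exact ⟨by have := h1.mp h; omega, h⟩
      · rintro ⟨_, h⟩; exact ⟨by omega, h⟩
    · rw [← map_mul, ← map_mul, mul_swap_eq_swap_mul, fixed_of_notMem hα hk]
  have hk0 : k ≠ 0 := by rintro rfl; simp at hk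
  obtain ⟨j, rfl⟩ := Fin.exists_succ_eq.mpr hk0
  have hj : j ∉ firstElements n r := by
    rw [mem_firstElements]; rw [Fin.val_succ] at hk; omega
  have hATB : A * T * B = A * B := by
    rw [hT, Finset.mul_sum, Finset.sum_mul, Finset.sum_eq_single 0]
    · rw [mul_assoc, of_mul_symmetrizer]
      exact fun i hi => swap_succ_fixed (Fin.succ_ne_zero i)
        (fun h => hj (Fin.succ_injective _ h ▸ hi))
    · intro a ha ha0
      obtain ⟨i, rfl⟩ := Fin.exists_succ_eq.mpr ha0
      refine antisymmetrizer_mul_swap_mul_symmetrizer ?_ hj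
      have := (Finset.mem_filter.mp ha).2
      rw [Fin.val_succ] at this
      rwa [mem_firstElements]
    · intro h
      exact absurd (by simp [Fin.lt_def]) h
  rw [← mul_assoc, hTA, hATB, Finset.sum_mul, Finset.sum_congr rfl (g := fun _ => A * B)]
  · rw [Finset.sum_const, ← natCast_zsmul]
    have hc : (Finset.filter (fun a : Fin (n + 1) => ¬ (a : ℕ) ≤ r) (Finset.Iio j.succ)).card
        = j.succ - (r + 1) := by
      have : Finset.filter (fun a : Fin (n + 1) => ¬ (a : ℕ) ≤ r) (Finset.Iio j.succ) =
          Finset.Ioo ⟨r, hk.trans j.succ.isLt⟩ j.succ := by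
        ext a
        simp [Fin.lt_def, and_comm]
      rw [this, Fin.card_Ioo, Nat.sub_sub]
    rw [hc, Nat.cast_sub hk]
    push_cast
    module
  · intro a ha
    simp only [Finset.mem_filter, Finset.mem_Iio, not_le, Fin.lt_def] at ha
    have hcomm : MonoidAlgebra.of ℤ _ (swap a j.succ) * A =
        A * MonoidAlgebra.of ℤ _ (swap a j.succ) := by
      refine commute_antisymmetrizer fun α hα => ?_
      rw [Commute, SemiconjBy, ← map_mul, ← map_mul, mul_swap_eq_swap_mul α,
        fixed_of_notMem hα ha.2, fixed_of_notMem hα hk]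
    rw [← mul_assoc, hcomm, mul_assoc, of_mul_symmetrizer]
    intro i hi
    rw [mem_firstElements] at hi
    refine swap_succ_fixed ?_ ?_ <;> simp only [ne_eq, Fin.ext_iff, Fin.val_succ] at hk ⊢ <;> omega

end HookElements

lemma monoSum_mul_of_eigenvector {d : ℕ} {v : MonoidAlgebra ℤ (Perm (Fin d))} {c : ℕ → ℤ}
    (hv : ∀ k : Fin d, jucysMurphy k * v = c k • v) {k : ℕ} (hk : k ≤ d) (m : ℕ) :
    monoSum d k m * v = (PowerSeries.coeff m (∏ j ∈ Finset.range k, geom (c j))) • v := by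
  induction k generalizing m with
  | zero =>
    cases m with
    | zero => simp [monoSum_zero_right]
    | succ m => simp [monoSum_zero_succ, PowerSeries.coeff_one]
  | succ k ih =>
    induction m with
    | zero => simp [monoSum_zero_right, geom, ← PowerSeries.coeff_zero_eq_constantCoeff_apply]
    | succ m ihm =>
      have h1 := monoSum_succ_succ (⟨k, hk⟩ : Fin d) m
      have h2 := hv ⟨k, hk⟩
      have h3 : ∏ j ∈ Finset.range (k + 1), geom (c j) = ∏ j ∈ Finset.range k, geom (c j) +
          PowerSeries.X * (PowerSeries.C (c k) * ∏ j ∈ Finset.range (k + 1), geom (c j)) := by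
        have := one_sub_mul_geom (c k)
        rw [← map_intCast (PowerSeries.C (R := ℤ)) (c k), Int.cast_id] at this
        rw [Finset.prod_range_succ]
        linear_combination (∏ j ∈ Finset.range k, geom (c j)) * this
      simp only at h1 h2
      have h4 : PowerSeries.coeff (m + 1) (∏ j ∈ Finset.range (k + 1), geom (c j)) =
          PowerSeries.coeff (m + 1) (∏ j ∈ Finset.range k, geom (c j)) +
            c k * PowerSeries.coeff m (∏ j ∈ Finset.range (k + 1), geom (c j)) := by
        conv_lhs => rw [h3]
        rw [map_add, PowerSeries.coeff_succ_X_mul, PowerSeries.coeff_C_mul]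
      rw [h1, add_mul, mul_assoc, h2, mul_smul_comm, ihm, ih (by omega), h4, add_smul, mul_smul]

lemma prod_geom_hook {n r : ℕ} (hr : r ≤ n) :
    ∏ k ∈ Finset.range (n + 1), geom (if k ≤ r then -(k : ℤ) else (k : ℤ) - r) =
      hookSeries (n + 1) r := by
  obtain ⟨s, rfl⟩ := Nat.exists_eq_add_of_le hr
  rw [hookSeries, show r + s + 1 = (r + 1) + s by ring, Finset.prod_range_add _ (r + 1) s,
    Finset.prod_range_add _ (r + 1) s]
  congr 1
  · rw [← Finset.prod_range_reflect (fun k : ℕ => geom ((k : ℤ) - r)) (r + 1)]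
    refine Finset.prod_congr rfl fun k hk => ?_
    have hk := Finset.mem_range.mp hk
    congr 1
    split_ifs with h <;> omega
  · refine Finset.prod_congr rfl fun k _ => ?_
    rw [if_neg (by omega)]

lemma monoSum_mul_hook_firstElements {n r : ℕ} (hr : r ≤ n) (m : ℕ) :
    monoSum (n + 1) (n + 1) m *
        (antisymmetrizer (firstElements n r) * symmetrizer (firstElements n r)) =
      (PowerSeries.coeff m (hookSeries (n + 1) r)) •
        (antisymmetrizer (firstElements n r) * symmetrizer (firstElements n r)) := by
  rw [← prod_geom_hook hr]
  refine monoSum_mul_of_eigenvector (c := fun k => if k ≤ r then -(k : ℤ) else (k : ℤ) - r)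
    (fun k => ?_) le_rfl m
  by_cases hk : (k : ℕ) ≤ r
  · simp only [if_pos hk]
    rw [← mul_assoc, jucysMurphy_mul_hook_of_le hk, smul_mul_assoc]
  · simp only [if_neg hk]
    exact jucysMurphy_mul_hook_of_lt (not_le.mp hk)

lemma exists_perm_firstElements {n : ℕ} (S : Finset (Fin n)) :
    ∃ g : Perm (Fin (n + 1)), ∃ e : Perm (Fin n), (∀ i, g i.succ = (e i).succ) ∧
      ∀ i, e i ∈ S ↔ i ∈ firstElements n S.card := by
  have hc : Fintype.card {i // i ∈ firstElements n S.card} = Fintype.card {i // i ∈ S} := by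
    have := Fin.card_filter_val_lt (n := n) (m := S.card)
    have hS := S.card_le_univ
    rw [Fintype.card_fin] at hS
    rw [Fintype.card_coe, Fintype.card_coe, firstElements, this, min_eq_right hS]
  let e := (Fintype.equivOfCardEq hc).extendSubtype
  refine ⟨Perm.decomposeFin.symm (0, e), e, fun i => by simp, fun i => ⟨fun h => ?_, fun h => ?_⟩⟩
  · by_contra h'
    exact (Fintype.equivOfCardEq hc).extendSubtype_not_mem i h' h
  · exact (Fintype.equivOfCardEq hc).extendSubtype_mem i h

lemma of_mul_hook {n : ℕ} {S T : Finset (Fin n)} {g : Perm (Fin (n + 1))} {e : Perm (Fin n)}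
    (hg : ∀ i, g i.succ = (e i).succ) (he : ∀ i, e i ∈ S ↔ i ∈ T) :
    MonoidAlgebra.of ℤ _ g * (antisymmetrizer T * symmetrizer T) =
      antisymmetrizer S * symmetrizer S * MonoidAlgebra.of ℤ _ g := by
  have hgi : ∀ i, g⁻¹ (e i).succ = i.succ := fun i => Perm.inv_eq_iff_eq.mpr (hg i).symm
  have key : ∀ (P Q : Fin n → Prop), (∀ i, P (e i) ↔ Q i) → ∀ α : Perm (Fin (n + 1)),
      (∀ i, Q i → α i.succ = i.succ) ↔ ∀ i, P i → (g * α * g⁻¹) i.succ = i.succ := by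
    intro P Q hPQ α
    rw [← e.forall_congr_right (q := fun i => P i → (g * α * g⁻¹) i.succ = i.succ)]
    refine forall_congr' fun i => ?_
    rw [hPQ, Perm.mul_apply, Perm.mul_apply, hgi, ← hg, g.injective.eq_iff]
  have hA : MonoidAlgebra.of ℤ _ g * antisymmetrizer T =
      antisymmetrizer S * MonoidAlgebra.of ℤ _ g := by
    rw [antisymmetrizer, antisymmetrizer, Finset.mul_sum, Finset.sum_mul]
    refine Finset.sum_equiv (MulAut.conj g).toEquiv (fun α => ?_) fun α _ => ?_
    · simpa using key (· ∉ S) (· ∉ T) (fun i => not_congr (he i)) α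
    · simp [mul_right_comm]
  have hB : MonoidAlgebra.of ℤ _ g * symmetrizer T =
      symmetrizer S * MonoidAlgebra.of ℤ _ g := by
    rw [symmetrizer, symmetrizer, Finset.mul_sum, Finset.sum_mul]
    refine Finset.sum_equiv (MulAut.conj g).toEquiv (fun α => ?_) fun α _ => ?_
    · simpa using key (· ∈ S) (· ∈ T) he α
    · simp
  rw [← mul_assoc, hA, mul_assoc, hB, mul_assoc]

lemma monoSum_mul_hook {n : ℕ} (S : Finset (Fin n)) (m : ℕ) :
    monoSum (n + 1) (n + 1) m * (antisymmetrizer S * symmetrizer S) =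
      (PowerSeries.coeff m (hookSeries (n + 1) S.card)) •
        (antisymmetrizer S * symmetrizer S) := by
  obtain ⟨g, e, hg, he⟩ := exists_perm_firstElements S
  have h := of_mul_hook hg he
  have hS : S.card ≤ n := by simpa using S.card_le_univ
  have h' : antisymmetrizer S * symmetrizer S = MonoidAlgebra.of ℤ _ g *
      (antisymmetrizer (firstElements n S.card) * symmetrizer (firstElements n S.card)) *
      MonoidAlgebra.of ℤ _ g⁻¹ := by
    rw [h, mul_assoc, ← map_mul, mul_inv_cancel, map_one, mul_one]
  rw [h', ← mul_assoc, ← mul_assoc, ← (commute_of_monoSum g m).eq,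
    mul_assoc (MonoidAlgebra.of ℤ _ g), monoSum_mul_hook_firstElements hS, mul_smul_comm,
    smul_mul_assoc]

lemma coeff_hook {n : ℕ} (S : Finset (Fin n)) (π : Perm (Fin (n + 1))) :
    (antisymmetrizer S * symmetrizer S).coeff π = ∑ α : Perm (Fin (n + 1)),
      if (∀ i ∉ S, α i.succ = i.succ) ∧ ∀ i ∈ S, α i.succ = π i.succ
        then (Perm.sign α : ℤ) else 0 := by
  have hB : ∀ τ : Perm (Fin (n + 1)), (symmetrizer S).coeff τ =
      if ∀ i ∈ S, τ i.succ = i.succ then 1 else 0 := by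
    intro τ
    rw [symmetrizer, MonoidAlgebra.coeff_sum, Finsupp.finsetSum_apply]
    simp [MonoidAlgebra.of_apply, Finsupp.single_apply]
  rw [antisymmetrizer, Finset.sum_mul, MonoidAlgebra.coeff_sum, Finsupp.finsetSum_apply,
    Finset.sum_filter]
  refine Finset.sum_congr rfl fun α _ => ?_
  rw [ite_and]
  refine if_congr Iff.rfl ?_ rfl
  rw [smul_mul_assoc, MonoidAlgebra.coeff_smul_apply, MonoidAlgebra.of_apply,
    MonoidAlgebra.coeff_single_mul_apply, hB, one_mul]
  rw [smul_eq_mul, mul_ite, mul_one, mul_zero]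
  refine if_congr (forall₂_congr fun i _ => ?_) rfl rfl
  rw [Perm.mul_apply, Perm.inv_eq_iff_eq, eq_comm]

lemma coeff_hook_one {n : ℕ} (S : Finset (Fin n)) :
    (antisymmetrizer S * symmetrizer S).coeff 1 = 1 := by
  rw [coeff_hook, Finset.sum_eq_single 1]
  · simp
  · intro α _ hα
    rw [if_neg]
    rintro ⟨h1, h2⟩
    have h : ∀ i : Fin n, α i.succ = i.succ := fun i => by
      by_cases hi : i ∈ S
      · exact h2 i hi
      · exact h1 i hi
    refine hα (Equiv.ext fun x => ?_)
    cases x using Fin.cases with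
    | succ i => exact h i
    | zero =>
      by_contra h0
      obtain ⟨i, hi⟩ := Fin.exists_succ_eq.mpr h0
      exact Fin.succ_ne_zero i (α.injective ((h i).trans hi))
  · simp

/-- The matrix obtained from `1 - P`, with `P` the permutation matrix of `π`, by replacing its
first column by a column of ones. -/
def hookMatrix {n : ℕ} (π : Perm (Fin (n + 1))) : Matrix (Fin (n + 1)) (Fin (n + 1)) ℤ :=
  Matrix.of fun y x => if x = 0 then 1 else (if y = x then 1 else 0) - if y = π x then 1 else 0

lemma det_hookMatrix_finRotate (n : ℕ) : (hookMatrix (finRotate (n + 1))).det = n + 1 := by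
  have h := Matrix.det_updateRow_sum (hookMatrix (finRotate (n + 1))) 0 (fun _ => 1)
  rw [one_smul] at h
  have hrow : (∑ k, (1 : ℤ) • hookMatrix (finRotate (n + 1)) k) =
      fun x => if x = 0 then (n : ℤ) + 1 else 0 := by
    ext x
    rw [Finset.sum_apply]
    by_cases hx : x = 0 <;> simp [hookMatrix, hx]
  rw [← h, hrow, Matrix.det_succ_row_zero, Finset.sum_eq_single 0]
  · rw [Matrix.det_of_isLowerTriangular]
    · cases n <;> simp [hookMatrix]
    · intro i j hij
      have hij : i < j := hij
      have h' : i.succ ≠ j.succ + 1 := fun h' => by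
        have := congrArg Fin.val h'
        rw [Fin.val_add_one, Fin.val_succ, Fin.val_succ] at this
        split_ifs at this
        omega
      simp [hookMatrix, hij.ne, h']
  · intro x _ hx
    simp [hx]
  · simp

lemma cycleType_eq_of_forall_sameCycle {n : ℕ} {π : Perm (Fin (n + 1))}
    (h : ∀ y, Perm.SameCycle π 0 y) : π.cycleType = (finRotate (n + 1)).cycleType := by
  cases n with
  | zero => rw [Subsingleton.elim (α := Perm (Fin 1)) π (finRotate 1)]
  | succ n =>
    have h0 : π 0 ≠ 0 := fun h0 => by
      obtain ⟨i, hi⟩ := h 1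
      rw [Perm.zpow_apply_eq_self_of_apply_eq_self h0] at hi
      simp at hi
    have hc : π.IsCycle := ⟨0, h0, fun y _ => h y⟩
    have hs : π.support = Finset.univ := by
      ext y
      simpa using fun hy => h0 ((h y).apply_eq_self_iff.mpr hy)
    rw [hc.cycleType, hs, cycleType_finRotate, Finset.card_univ, Fintype.card_fin]

lemma det_hookMatrix_of_not_sameCycle {n : ℕ} {π : Perm (Fin (n + 1))} {y : Fin (n + 1)}
    (hy : ¬ Perm.SameCycle π 0 y) : (hookMatrix π).det = 0 := by
  classical
  let C : Finset (Fin (n + 1)) := {y | Perm.SameCycle π 0 y}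
  refine Matrix.exists_vecMul_eq_zero_iff.mp
    ⟨fun y => if y ∈ C then (Cᶜ.card : ℤ) else -(C.card : ℤ), fun h => ?_, ?_⟩
  · have h0 := congrFun h 0
    have hy' : y ∈ Cᶜ := by simpa [C] using hy
    have h1 : (0 : Fin (n + 1)) ∈ C := by
      simpa [C] using Perm.SameCycle.refl π 0
    simp only [h1, if_true, Pi.zero_apply, Nat.cast_eq_zero, Finset.card_eq_zero] at h0
    simp [h0] at hy'
  · ext x
    by_cases hx : x = 0
    · have hC : ({y | y ∉ C} : Finset (Fin (n + 1))) = Cᶜ := by ext; simp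
      simp [Matrix.vecMul, dotProduct, hookMatrix, hx, Finset.sum_ite, hC, mul_comm]
    · simp [Matrix.vecMul, dotProduct, hookMatrix, hx, mul_sub, Finset.sum_sub_distrib, C]

lemma det_hookMatrix {n : ℕ} (π : Perm (Fin (n + 1))) : (hookMatrix π).det =
    if π.cycleType = (finRotate (n + 1)).cycleType then (n : ℤ) + 1 else 0 := by
  split_ifs with h
  · obtain ⟨c, hc⟩ := isConj_iff.mp (Perm.isConj_of_cycleType_eq h.symm)
    let g : Perm (Fin (n + 1)) := c * Equiv.addRight (c⁻¹ 0)
    have hg0 : g 0 = 0 := by simp [g]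
    have hg : ∀ x, π (g x) = g (finRotate (n + 1) x) := fun x => by
      rw [← hc]
      simp [g, add_right_comm]
    rw [← det_hookMatrix_finRotate n, ← Matrix.det_submatrix_equiv_self g (hookMatrix π)]
    congr 1
    ext y x
    have hx : g x = 0 ↔ x = 0 := by rw [← hg0, g.injective.eq_iff, hg0]
    simp only [hookMatrix, Matrix.submatrix_apply, Matrix.of_apply, hx, hg, g.injective.eq_iff]
  · by_contra h'
    refine h (cycleType_eq_of_forall_sameCycle fun y => ?_)
    by_contra hy
    exact h' (det_hookMatrix_of_not_sameCycle hy)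

lemma sum_coeff_hook {n : ℕ} (π : Perm (Fin (n + 1))) :
    ∑ S : Finset (Fin n), (-1) ^ S.card * (antisymmetrizer S * symmetrizer S).coeff π =
      (hookMatrix π).det := by
  rw [Matrix.det_apply']
  simp_rw [coeff_hook, Finset.mul_sum]
  rw [Finset.sum_comm]
  refine Finset.sum_congr rfl fun α _ => ?_
  rw [Fin.prod_univ_succ]
  simp only [hookMatrix, Matrix.of_apply, if_true, one_mul, Fin.succ_ne_zero, if_false]
  simp_rw [sub_eq_neg_add]
  rw [Finset.prod_add, Finset.mul_sum, Finset.powerset_univ]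
  refine Finset.sum_congr rfl fun S _ => ?_
  rw [Finset.prod_neg, Finset.prod_ite_zero, Finset.prod_ite_zero]
  simp only [Finset.mem_sdiff, Finset.mem_univ, true_and, Finset.prod_const_one]
  rw [ite_and]
  split_ifs <;> simp [mul_comm]

open Classical in
lemma coeff_monoSum (n m : ℕ) (π : Perm (Fin (n + 1))) :
    (monoSum (n + 1) (n + 1) m).coeff π =
      (({f : Fin m → Fin (n + 1) × Fin (n + 1) | IsMonotoneBelow (n + 1) f ∧ swapProd f = π} :
        Finset _).card : ℤ) := by
  rw [monoSum, MonoidAlgebra.coeff_sum, Finsupp.finsetSum_apply]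
  simp [MonoidAlgebra.of_apply, Finsupp.single_apply, Finset.filter_filter]

lemma coeff_hookSum (n m : ℕ) : PowerSeries.coeff m (hookSum n) = (n + 1) *
    ∑ π : Perm (Fin (n + 1)) with π.cycleType = (finRotate (n + 1)).cycleType,
      (monoSum (n + 1) (n + 1) m).coeff π := by
  have h : ∀ S : Finset (Fin n), PowerSeries.coeff m (hookSeries (n + 1) S.card) =
      ∑ π : Perm (Fin (n + 1)), (monoSum (n + 1) (n + 1) m).coeff π⁻¹ *
        (antisymmetrizer S * symmetrizer S).coeff π := by
    intro S
    have h1 := congrArg (fun x => x.coeff 1) (monoSum_mul_hook S m)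
    simp only [MonoidAlgebra.coeff_smul_apply, coeff_hook_one, smul_eq_mul, mul_one] at h1
    rw [← h1, MonoidAlgebra.coeff_mul_apply_right]
    rw [Finsupp.sum_fintype _ _ (by simp)]
    simp
  have h2 : PowerSeries.coeff m (hookSum n) = ∑ S : Finset (Fin n),
      (-1) ^ S.card * PowerSeries.coeff m (hookSeries (n + 1) S.card) := by
    rw [hookSum, map_sum, ← Finset.powerset_univ, Finset.sum_powerset_apply_card
      (fun r => (-1) ^ r * PowerSeries.coeff m (hookSeries (n + 1) r))]
    rw [Finset.card_univ, Fintype.card_fin]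
    refine Finset.sum_congr rfl fun r _ => ?_
    have e : (-1) ^ r * (n.choose r : PowerSeries ℤ) =
        PowerSeries.C ((-1) ^ r * (n.choose r : ℤ)) := by simp
    rw [e, PowerSeries.coeff_C_mul, nsmul_eq_mul]
    ring
  rw [h2]
  simp_rw [h, Finset.mul_sum]
  rw [Finset.sum_comm, Finset.sum_filter]
  refine Finset.sum_equiv (Equiv.inv _) (by simp) fun π _ => ?_
  simp_rw [mul_left_comm _ ((monoSum (n + 1) (n + 1) m).coeff π⁻¹)]
  rw [← Finset.mul_sum, sum_coeff_hook, det_hookMatrix]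
  simp [Perm.cycleType_inv, mul_comm]

lemma coeff_hookSum_eq_mono (n m : ℕ) :
    PowerSeries.coeff m (hookSum n) = (n + 1) * (Mono (n + 1) m : ℤ) := by
  classical
  rw [coeff_hookSum, Mono, Nat.card_eq_fintype_card, Fintype.card_subtype]
  simp_rw [coeff_monoSum]
  rw [← Nat.cast_sum, ← Finset.card_biUnion]
  · congr 3
    ext f
    simp [IsMonotoneBelow, swapProd, -Order.lt_add_one_iff]
    tauto
  · intro π _ σ _ h
    refine Finset.disjoint_filter.mpr fun f _ h1 h2 => h (h1.2.symm.trans h2.2)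

lemma mono_succ_succ (n m : ℕ) : (n + 2) * (Mono (n + 2) (m + 2) : ℤ) =
    2 * (2 * n + 1) * ((n + 1) * (Mono (n + 1) (m + 1) : ℤ)) +
      (n + 1) ^ 2 * ((n + 2) * (Mono (n + 2) m : ℤ)) := by
  have h := coeff_hookSum_succ n m
  rw [coeff_hookSum_eq_mono, coeff_hookSum_eq_mono, coeff_hookSum_eq_mono] at h
  push_cast at h
  linear_combination h

lemma mono_succ_self (n : ℕ) : (n + 2) * (Mono (n + 2) (n + 1) : ℤ) =
    2 * (2 * n + 1) * ((n + 1) * (Mono (n + 1) n : ℤ)) := by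
  have h := coeff_hookSum_succ_self n
  rw [coeff_hookSum_eq_mono, coeff_hookSum_eq_mono] at h
  push_cast at h
  linear_combination h

end MonotoneHurwitz

/-- The 1-point recursion for 1-part monotone Hurwitz numbers:
`d·m_g(d) = 2(2d−3)·m_g(d−1) + d(d−1)²·m_{g−1}(d)`. -/
theorem monotone_hurwitz_one_point_recursion (g : ℤ) (d : ℕ) (hg : 0 ≤ g) (hd : 2 ≤ d) :
    (d : ℚ) * monotoneHurwitz g d =
      2 * (2 * (d : ℚ) - 3) * monotoneHurwitz g (d - 1) +
        (d : ℚ) * ((d : ℚ) - 1) ^ 2 * monotoneHurwitz (g - 1) d := by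
  obtain ⟨n, rfl⟩ := Nat.exists_eq_add_of_le' hd
  obtain ⟨k, rfl⟩ := Int.eq_ofNat_of_zero_le hg
  have hn : ((n + 1).factorial : ℚ) = (n + 1) * n.factorial := by
    rw [Nat.factorial_succ]; push_cast; ring
  have hf : (n.factorial : ℚ) ≠ 0 := by exact_mod_cast n.factorial_ne_zero
  have hn1 : (n : ℚ) + 1 ≠ 0 := by positivity
  have e1 : n + 2 - 1 = n + 1 := rfl
  have e2 : n + 1 - 1 = n := rfl
  cases k with
  | zero =>
    have h := congrArg (Int.cast : ℤ → ℚ) (MonotoneHurwitz.mono_succ_self n)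
    simp only [monotoneHurwitz, e1, e2, hn]
    push_cast at h ⊢
    simp
    field_simp
    linear_combination h
  | succ k =>
    have h := congrArg (Int.cast : ℤ → ℚ) (MonotoneHurwitz.mono_succ_succ n (n + 2 * k + 1))
    have h1 : ¬ ((k + 1 : ℕ) : ℤ) < 0 := by omega
    have h2 : ((k + 1 : ℕ) : ℤ) - 1 = (k : ℕ) := by simp
    have h3 : ¬ ((k : ℕ) : ℤ) < 0 := by omega
    simp only [monotoneHurwitz, e1, e2, hn, if_neg h1, h2, if_neg h3, Int.toNat_natCast]
    rw [show n + 2 + 2 * (k + 1) - 1 = n + 2 * k + 1 + 2 by omega,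
      show n + 1 + 2 * (k + 1) - 1 = n + 2 * k + 1 + 1 by omega,
      show n + 2 + 2 * k - 1 = n + 2 * k + 1 by omega]
    push_cast at h ⊢
    field_simp
    linear_combination h
end

section
/- (Partial fraction identity for the monotone 1-point function) Let ħ be an indeterminate. For every integer d ≥ 1, the following identity holds in the field ℚ(ħ) of rational functions: Σ_{k=1}^{d} (−1)^{d−k} · binom(d−1, k−1) · ∏_{i=1}^{d} (1 − (k−i)ħ)^{−1} = ħ^{d−1} · ( (2d−2)!/(d−1)! ) · ∏_{j=1−d}^{d−1} (1 − jħ)^{−1}. -/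
/-- Iterated forward differences of a product of `p + 1` consecutive reciprocals
`(1 - j x)⁻¹`, as a function of the largest index `j`. -/
theorem fwdDiff_iter_prod_inv_one_sub_mul {K : Type*} [Field K] {x : K}
    (hx : ∀ j : ℤ, 1 - (j : K) * x ≠ 0) (p r : ℕ) (m : ℤ) :
    (fwdDiff 1)^[r] (fun m : ℤ ↦ ∏ i ∈ Finset.range (p + 1), (1 - ((m - i : ℤ) : K) * x)⁻¹) m =
      ((p + 1).ascFactorial r : K) * x ^ r *
        ∏ i ∈ Finset.range (p + r + 1), (1 - ((m + r - i : ℤ) : K) * x)⁻¹ := by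
  induction r generalizing m with
  | zero => simp
  | succ r ih =>
    rw [Function.iterate_succ_apply', fwdDiff, ih, ih]
    have first : ∏ i ∈ Finset.range (p + (r + 1) + 1),
          (1 - ((m + (r + 1 : ℕ) - i : ℤ) : K) * x)⁻¹ =
        (∏ i ∈ Finset.range (p + r + 1), (1 - ((m + r - i : ℤ) : K) * x)⁻¹) *
          (1 - ((m + r + 1 : ℤ) : K) * x)⁻¹ := by
      rw [← add_assoc p, Finset.prod_range_succ']
      congr 1
      · refine Finset.prod_congr rfl fun i _ ↦ ?_
        push_cast
        ring
      · push_cast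
        ring
    have last : ∏ i ∈ Finset.range (p + (r + 1) + 1),
          (1 - ((m + (r + 1 : ℕ) - i : ℤ) : K) * x)⁻¹ =
        (∏ i ∈ Finset.range (p + r + 1), (1 - ((m + 1 + r - i : ℤ) : K) * x)⁻¹) *
          (1 - ((m - p : ℤ) : K) * x)⁻¹ := by
      rw [← add_assoc p, Finset.prod_range_succ]
      congr 1
      · refine Finset.prod_congr rfl fun i _ ↦ ?_
        push_cast
        ring
      · push_cast
        ring
    rw [← div_eq_mul_inv, eq_div_iff (hx _)] at first last
    rw [← first, ← last, Nat.ascFactorial_succ]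
    push_cast
    ring

theorem RatFunc.one_sub_intCast_mul_X_ne_zero {K : Type*} [Field K] (j : ℤ) :
    1 - (j : RatFunc K) * RatFunc.X ≠ 0 := by
  have hp : (1 - (j : Polynomial K) * Polynomial.X) ≠ 0 := fun h ↦ by
    simpa using congrArg (Polynomial.eval 0) h
  simpa using RatFunc.algebraMap_ne_zero hp

/-- Partial fraction identity in `ℚ(ħ)` underlying the product form of the 1-point
function of monotone Hurwitz numbers:
`Σ_{k=1}^{d} (−1)^{d−k} C(d−1,k−1) ∏_{i=1}^{d} (1−(k−i)ħ)⁻¹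
  = ħ^{d−1} ((2d−2)!/(d−1)!) ∏_{j=1−d}^{d−1} (1−jħ)⁻¹`. -/
theorem monotone_partial_fraction_identity (d : ℕ) (hd : 1 ≤ d) :
    ∑ k ∈ Finset.Icc 1 d,
        (-1 : RatFunc ℚ) ^ (d - k) * ((d - 1).choose (k - 1) : RatFunc ℚ) *
          ∏ i ∈ Finset.Icc 1 d,
            (1 - (((k : ℤ) - (i : ℤ) : ℤ) : RatFunc ℚ) * RatFunc.X)⁻¹ =
      RatFunc.X ^ (d - 1) *
          (((2 * d - 2).factorial : RatFunc ℚ) / ((d - 1).factorial : RatFunc ℚ)) *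
        ∏ j ∈ Finset.Icc (1 - (d : ℤ)) ((d : ℤ) - 1),
          (1 - (j : RatFunc ℚ) * RatFunc.X)⁻¹ := by
  obtain ⟨n, rfl⟩ := Nat.exists_eq_add_of_le' hd
  have key := fwdDiff_iter_prod_inv_one_sub_mul
    (RatFunc.one_sub_intCast_mul_X_ne_zero (K := ℚ)) n n 0
  rw [fwdDiff_iter_eq_sum_shift] at key
  have shift {M : Type} [AddCommMonoid M] (g : ℕ → M) :
      ∑ k ∈ Finset.Icc 1 (n + 1), g k = ∑ k ∈ Finset.range (n + 1), g (k + 1) := by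
    rw [Finset.range_eq_Ico, Finset.sum_Ico_add' g 0 (n + 1) 1]
    rfl
  have shift_prod (g : ℕ → RatFunc ℚ) :
      ∏ k ∈ Finset.Icc 1 (n + 1), g k = ∏ k ∈ Finset.range (n + 1), g (k + 1) :=
    shift (M := Additive (RatFunc ℚ)) g
  have window (g : ℤ → RatFunc ℚ) :
      ∏ j ∈ Finset.Icc (1 - ((n + 1 : ℕ) : ℤ)) (((n + 1 : ℕ) : ℤ) - 1), g j =
        ∏ i ∈ Finset.range (n + n + 1), g (0 + n - i) := by
    refine Finset.prod_bij' (fun j _ ↦ (n - j).toNat) (fun i _ ↦ 0 + n - i) ?_ ?_ ?_ ?_ ?_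
    · intro j hj
      simp only [Finset.mem_Icc, Finset.mem_range] at *
      omega
    · intro i hi
      simp only [Finset.mem_Icc, Finset.mem_range] at *
      omega
    · intro j hj
      simp only [Finset.mem_Icc] at *
      omega
    · intro i hi
      omega
    · intro j hj
      simp only [Finset.mem_Icc] at *
      congr 1
      omega
  have hfac : ((2 * (n + 1) - 2).factorial : RatFunc ℚ) / ((n + 1 - 1).factorial : RatFunc ℚ) =
      ((n + 1).ascFactorial n : RatFunc ℚ) := by
    rw [div_eq_iff (by exact_mod_cast Nat.factorial_ne_zero _), Nat.add_sub_cancel,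
      show 2 * (n + 1) - 2 = n + n by omega, ← Nat.factorial_mul_ascFactorial]
    push_cast
    ring
  rw [window, hfac, Nat.add_sub_cancel, mul_comm (RatFunc.X ^ n), ← key, shift]
  refine Finset.sum_congr rfl fun k _ ↦ ?_
  rw [shift_prod, zsmul_eq_mul, Nat.add_sub_add_right, Nat.add_sub_cancel]
  push_cast
  congr 1
  refine Finset.prod_congr rfl fun i _ ↦ ?_
  simp
end
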